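/- arXiv:1602.02613 — 3 statements merged into one kernel-verified Lean document; each statement's English description precedes it below -/
import Mathlib

section
/- Let T be a tower of type (m,n) over a minimal rotation. If m and n are not relatively prime, and d > 1 is their greatest common divisor, then T is conjugate in 𝔾 to a tower of constant height d over a minimal rotation. -/
open Set

namespace IETRoots

noncomputable section

/-- The unit interval `[0,1)`, the domain of our interval exchange transformations. -/
def unitI : Set ℝ := Set.Ico 0 1

/-- `T : ℝ → ℝ` is (the extension by the identity of) an interval exchange
transformation: it fixes the complement of `[0,1)`, maps `[0,1)` bijectively onto
itself, and there is a finite partition of `[0,1)` into half-open intervals on each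
of which `T` is a translation.  The group `𝔾` of IETs is the set of such maps under
composition. -/
def IsIET (T : ℝ → ℝ) : Prop :=
  Set.BijOn T unitI unitI ∧ (∀ x, x ∉ unitI → T x = x) ∧
  ∃ (k : ℕ) (β : Fin (k + 1) → ℝ), StrictMono β ∧ β 0 = 0 ∧ β (Fin.last k) = 1 ∧
    ∀ i : Fin k, ∃ c : ℝ, ∀ x ∈ Set.Ico (β i.castSucc) (β i.succ), T x = x + c

/-- The `ℤ`-orbit `{T^n x : n ∈ ℤ}` of `x` under the bijection `T`. -/
def orbitZ (T : ℝ → ℝ) (x : ℝ) : Set ℝ := {y | ∃ n : ℕ, T^[n] x = y ∨ T^[n] y = x}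

/-- `T` is minimal: every orbit is dense in `[0,1)`. -/
def IsMinimal (T : ℝ → ℝ) : Prop := ∀ x ∈ unitI, unitI ⊆ closure (orbitZ T x)

/-- `T` is of rotation type: `T x = x + α (mod 1)` on `[0,1)`. -/
def IsRotationType (T : ℝ → ℝ) : Prop := ∃ α : ℝ, ∀ x ∈ unitI, T x = Int.fract (x + α)

/-- `T` has an `n`-th root in the group `𝔾` of IETs for some `n ≥ 2`. -/
def HasNontrivialRoot (T : ℝ → ℝ) : Prop :=
  ∃ (S : ℝ → ℝ) (n : ℕ), IsIET S ∧ 2 ≤ n ∧ S^[n] = T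

/-- The set `D(T)` of points of `[0,1)` at which `T` is discontinuous
(as a map of `[0,1)`). -/
def DiscSet (T : ℝ → ℝ) : Set ℝ := {x | x ∈ unitI ∧ ¬ ContinuousWithinAt T unitI x}

/-- `β_j = λ_1 + ⋯ + λ_j` (`0`-indexed: the sum of the first `j` lengths). -/
def betaPt {m : ℕ} (lam : Fin m → ℝ) (j : ℕ) : ℝ :=
  ∑ i ∈ Finset.univ.filter (fun i : Fin m => (i : ℕ) < j), lam i

/-- The interval exchange transformation `T_{(π,λ)}` determined by a permutation
`π ∈ S_m` and a length vector `λ`: on `I_j = [β_{j-1}, β_j)` it is given by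
`x ↦ x - ∑_{i<j} λ_i + ∑_{π(i)<π(j)} λ_i`; outside `[0,1)` it is the identity. -/
noncomputable def ietMap {m : ℕ} (π : Equiv.Perm (Fin m)) (lam : Fin m → ℝ) : ℝ → ℝ :=
  fun x =>
    if h : ∃ j : Fin m, x ∈ Set.Ico (betaPt lam (j : ℕ)) (betaPt lam (j : ℕ) + lam j) then
      x - betaPt lam (h.choose : ℕ) +
        ∑ i ∈ Finset.univ.filter (fun i : Fin m => π i < π h.choose), lam i
    else x

/-- A permutation `π ∈ S_m` is separating if `π(i+1) ≠ π(i) + 1` for `1 ≤ i ≤ m-1`. -/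
def Separating {m : ℕ} (π : Equiv.Perm (Fin m)) : Prop :=
  ∀ i j : Fin m, (j : ℕ) = (i : ℕ) + 1 → (π j : ℕ) ≠ (π i : ℕ) + 1

/-- A permutation `π ∈ S_m` is irreducible if `π({1,…,k}) ≠ {1,…,k}` for all `k < m`. -/
def IrreduciblePerm {m : ℕ} (π : Equiv.Perm (Fin m)) : Prop :=
  ∀ k : ℕ, 1 ≤ k → k < m → ∃ i : Fin m, (i : ℕ) < k ∧ k ≤ (π i : ℕ)

/-- The endpoints `0 = γ_0 < γ_1 < ⋯ < γ_{m-1} < γ_m = 1`, namely the discontinuities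
of `T` together with `0` and `1`. -/
def endpointsOf (T : ℝ → ℝ) : Set ℝ := insert 0 (insert 1 (DiscSet T))

/-- The set of lengths `l_j = γ_j - γ_{j-1}` of the intervals of continuity of `T`,
i.e. the gaps between consecutive endpoints. -/
def gapLengths (T : ℝ → ℝ) : Set ℝ :=
  {l | ∃ a ∈ endpointsOf T, ∃ b ∈ endpointsOf T,
        a < b ∧ (∀ c ∈ endpointsOf T, ¬(a < c ∧ c < b)) ∧ l = b - a}

/-- The rank of `T`: the dimension of the `ℚ`-vector space spanned by the lengths
`l_1, …, l_m`. -/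
noncomputable def ietRank (T : ℝ → ℝ) : ℕ :=
  Module.finrank ℚ (Submodule.span ℚ (gapLengths T))

/-- Keane's infinite distinct orbit condition for an `m`-IET `T = T_{(π,λ)}`:
the orbits of `β_1, …, β_{m-1}` are infinite and pairwise disjoint. -/
def SatisfiesIDOC {m : ℕ} (lam : Fin m → ℝ) (T : ℝ → ℝ) : Prop :=
  (∀ j : ℕ, 1 ≤ j → j ≤ m - 1 → (orbitZ T (betaPt lam j)).Infinite) ∧
  ∀ j j' : ℕ, 1 ≤ j → j ≤ m - 1 → 1 ≤ j' → j' ≤ m - 1 → j ≠ j' →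
    orbitZ T (betaPt lam j) ∩ orbitZ T (betaPt lam j') = ∅

/-- A rotation: a `2`-IET with permutation `(21)`, i.e. `x ↦ x + α (mod 1)`
with `α ∈ (0,1)`. -/
def IsRotation (S : ℝ → ℝ) : Prop :=
  (∀ x, x ∉ unitI → S x = x) ∧ ∃ α ∈ Set.Ioo (0 : ℝ) 1, ∀ x ∈ unitI, S x = Int.fract (x + α)

/-- Conjugacy in the group `𝔾` of IETs. -/
def IsConjugate (T T' : ℝ → ℝ) : Prop := ∃ g : ℝ → ℝ, IsIET g ∧ g ∘ T = T' ∘ g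

/-- `T` is a tower of type `(n_1, …, n_k)` over the `k`-IET `S`:  there is a partition
`0 = t_0 < t_1 < ⋯ < t_k = 1` into intervals `I_i` on which `S` is a translation, a
scaling factor `c > 0`, and for each `i` a family of `n_i` pairwise disjoint "levels"
(scaled copies of `I_i`) which together partition `[0,1)`, such that `T` translates each
level of the `i`-th column onto the next one, and maps the top level back to the bottom
levels according to `S` (all after rescaling by `c`). -/
def IsTowerOver {k : ℕ} (T : ℝ → ℝ) (n : Fin k → ℕ) (S : ℝ → ℝ) : Prop :=
  IsIET T ∧ IsIET S ∧ (∀ i, 0 < n i) ∧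
  ∃ (t : Fin (k + 1) → ℝ) (c : ℝ) (a : Fin k → ℕ → ℝ),
    StrictMono t ∧ t 0 = 0 ∧ t (Fin.last k) = 1 ∧ 0 < c ∧
    (∀ i : Fin k, ∃ d : ℝ, ∀ x ∈ Set.Ico (t i.castSucc) (t i.succ), S x = x + d) ∧
    (∀ i : Fin k, ∀ j : ℕ, j < n i →
      Set.Ico (a i j) (a i j + c * (t i.succ - t i.castSucc)) ⊆ unitI) ∧
    (∀ i i' : Fin k, ∀ j j' : ℕ, j < n i → j' < n i' → (i, j) ≠ (i', j') →
      Disjoint (Set.Ico (a i j) (a i j + c * (t i.succ - t i.castSucc)))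
        (Set.Ico (a i' j') (a i' j' + c * (t i'.succ - t i'.castSucc)))) ∧
    (∀ y ∈ unitI, ∃ (i : Fin k) (j : ℕ), j < n i ∧
      y ∈ Set.Ico (a i j) (a i j + c * (t i.succ - t i.castSucc))) ∧
    (∀ i : Fin k, ∀ j : ℕ, j + 1 < n i → ∀ x ∈ Set.Ico (t i.castSucc) (t i.succ),
      T (a i j + c * (x - t i.castSucc)) = a i (j + 1) + c * (x - t i.castSucc)) ∧
    (∀ i : Fin k, ∀ x ∈ Set.Ico (t i.castSucc) (t i.succ), ∀ i' : Fin k,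
      S x ∈ Set.Ico (t i'.castSucc) (t i'.succ) →
      T (a i (n i - 1) + c * (x - t i.castSucc)) = a i' 0 + c * (S x - t i'.castSucc))

/-- The data of the first return map of `T` to `J = [a,b)`: a partition
`a = s_0 < s_1 < ⋯ < s_k = b` of `J`, return times `mt_i ≥ 1` and translation
constants `c_i` such that for `x` in the `i`-th piece the iterates `T^j x`, `0 < j < mt_i`,
avoid `J`, while `T^{mt_i} x = x + c_i ∈ J`.  Thus the first return map `T_J` is the
`k`-IET `x ↦ x + c_i` on the `i`-th piece. -/
def IsFirstReturnSystem (T : ℝ → ℝ) (a b : ℝ) {k : ℕ} (s : Fin (k + 1) → ℝ)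
    (mt : Fin k → ℕ) (c : Fin k → ℝ) : Prop :=
  StrictMono s ∧ s 0 = a ∧ s (Fin.last k) = b ∧
  ∀ i : Fin k, 0 < mt i ∧ ∀ x ∈ Set.Ico (s i.castSucc) (s i.succ),
    (∀ j : ℕ, 0 < j → j < mt i → T^[j] x ∉ Set.Ico a b) ∧
    T^[mt i] x ∈ Set.Ico a b ∧ T^[mt i] x = x + c i

/-- A finite sequence `x_0, …, x_k` is an `S`-chain if `x_0` and `x_k` lie in
`D(S) ∪ {0}` and `S x_i = x_{i+1}`. -/
def IsSChainSeq (S : ℝ → ℝ) {k : ℕ} (x : Fin (k + 1) → ℝ) : Prop :=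
  x 0 ∈ insert (0 : ℝ) (DiscSet S) ∧ x (Fin.last k) ∈ insert (0 : ℝ) (DiscSet S) ∧
  ∀ i : Fin k, S (x i.castSucc) = x i.succ

/-- A set `C ⊆ ℝ` is (the underlying set of) an `S`-chain. -/
def IsSChain (S : ℝ → ℝ) (C : Set ℝ) : Prop :=
  ∃ (k : ℕ) (x : Fin (k + 1) → ℝ), IsSChainSeq S x ∧ C = Set.range x

/-- A maximal `S`-chain: an `S`-chain which is not a proper subset of another `S`-chain. -/
def IsMaximalSChain (S : ℝ → ℝ) (C : Set ℝ) : Prop :=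
  IsSChain S C ∧ ∀ C', IsSChain S C' → C ⊆ C' → C = C'

/-- The open simplex `Δ_m ⊆ ℝ^m`. -/
def simplexSet (m : ℕ) : Set (Fin m → ℝ) := {lam | (∀ i, 0 < lam i) ∧ ∑ i, lam i = 1}

/-- The affine chart identifying (a superset of) `Δ_m` with a subset of `ℝ^{m-1}`:
`λ_i = x_i` for `i < m-1` and `λ_{m-1} = 1 - ∑ x_j`.  Lebesgue measure on `Δ_m`
is the `(m-1)`-dimensional Lebesgue measure carried through this chart. -/
def chartMap (m : ℕ) (x : Fin (m - 1) → ℝ) : Fin m → ℝ := fun i =>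
  if h : (i : ℕ) < m - 1 then x ⟨(i : ℕ), h⟩ else 1 - ∑ j, x j

/-- The permutation `(321) ∈ S_3`, sending `1 ↦ 3`, `2 ↦ 2`, `3 ↦ 1`. -/
def perm321 : Equiv.Perm (Fin 3) :=
  ⟨fun i => i.rev, fun i => i.rev, fun i => Fin.rev_rev i, fun i => Fin.rev_rev i⟩

end

lemma isIET_of_pieces (g : ℝ → ℝ) (hb : BijOn g unitI unitI) (ho : ∀ x, x ∉ unitI → g x = x)
    (F : Finset ℝ)
    (h : ∀ y ∈ unitI, ∃ v ∈ F, y < v ∧ ∃ c, ∀ x ∈ Ico y v, g x = x + c) : IsIET g := by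
  classical
  refine ⟨hb, ho, ?_⟩
  set G : Finset ℝ := insert 0 (insert 1 (F.filter (fun x => 0 ≤ x ∧ x ≤ 1))) with hG
  have h0 : (0 : ℝ) ∈ G := by simp [hG]
  have h1 : (1 : ℝ) ∈ G := by simp [hG]
  have hG01 : ∀ x ∈ G, 0 ≤ x ∧ x ≤ 1 := by
    intro x hx
    simp only [hG, Finset.mem_insert, Finset.mem_filter] at hx
    rcases hx with rfl | rfl | hx
    · norm_num
    · norm_num
    · exact hx.2
  have hpos : 0 < G.card := Finset.card_pos.2 ⟨0, h0⟩
  obtain ⟨k, hk⟩ : ∃ k, G.card = k + 1 := ⟨G.card - 1, by omega⟩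
  set β := G.orderEmbOfFin hk with hβ
  have hmem : ∀ i, β i ∈ G := fun i => Finset.orderEmbOfFin_mem _ _ _
  have hsurj : ∀ x ∈ G, ∃ i, β i = x := by
    intro x hx
    have := Finset.range_orderEmbOfFin G hk
    have hx' : x ∈ (G : Set ℝ) := hx
    rw [← this] at hx'
    exact hx'
  refine ⟨k, β, β.strictMono, ?_, ?_, ?_⟩
  · obtain ⟨i, hi⟩ := hsurj 0 h0
    have := β.monotone (Fin.zero_le i)
    have := (hG01 _ (hmem 0)).1
    linarith
  · obtain ⟨i, hi⟩ := hsurj 1 h1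
    have := β.monotone (Fin.le_last i)
    have := (hG01 _ (hmem (Fin.last k))).2
    linarith
  · intro i
    have hlt : β i.castSucc < β i.succ := β.strictMono (Fin.castSucc_lt_succ)
    have hle1 := (hG01 _ (hmem i.succ)).2
    have hge0 := (hG01 _ (hmem i.castSucc)).1
    obtain ⟨v, hvF, hyv, c, hc⟩ := h (β i.castSucc) ⟨hge0, by linarith⟩
    refine ⟨c, fun x hx => hc x ⟨hx.1, lt_of_lt_of_le hx.2 ?_⟩⟩
    by_cases hv1 : v ≤ 1
    · have hvG : v ∈ G := by
        simp only [hG, Finset.mem_insert, Finset.mem_filter]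
        exact Or.inr (Or.inr ⟨hvF, by linarith, hv1⟩)
      obtain ⟨j, hj⟩ := hsurj v hvG
      rw [← hj] at hyv ⊢
      have := β.strictMono.lt_iff_lt.1 hyv
      apply β.monotone
      rw [Fin.le_def]
      rw [Fin.lt_def] at this
      simp at this ⊢
      omega
    · linarith

/-- Arithmetic core: injectivity. -/
lemma arith_inj_aux (p q : ℕ) (hp : 0 < p) (hq : 0 < q) (α κ θ : ℝ) (k l : ℤ)
    (hα0 : 0 < α) (hα1 : α < 1)
    (hkl : (p : ℤ) * l - q * k = 1) (hκ : κ * (p + (q - p) * α) = 1)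
    (hθ : θ = κ * ((l - k) * α + k)) (x x' : ℝ) (hx0 : 0 ≤ x) (hx1 : x < 1)
    (hx0' : 0 ≤ x') (hx1' : x' < 1) (j j' : ℕ)
    (hj' : (j' : ℤ) < if x' < 1 - α then (p : ℤ) else q)
    (b : ℤ) (hb : (x * κ + j * θ) - (x' * κ + j' * θ) = b)
    (hu : 0 ≤ b * (q - p) - ((j : ℤ) - j') * (l - k)) : x = x' ∧ j = j' := by
  have hκ0 : κ ≠ 0 := by rintro rfl; simp at hκ
  set a : ℤ := (j : ℤ) - j' with ha
  set u : ℤ := b * (q - p) - a * (l - k) with hudef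
  set B : ℤ := -(b * p - a * k) with hB
  have hklR : (p : ℝ) * l - q * k = 1 := by exact_mod_cast hkl
  have key : x = x' + u * α - B := by
    have haR : (a : ℝ) = (j : ℝ) - j' := by simp [ha]
    have : κ * (x - x') = κ * (u * α - B) := by
      have e1 : κ * (x - x') = b - a * θ := by rw [haR]; linarith
      have e2 : (b : ℝ) = b * (κ * (p + (q - p) * α)) := by rw [hκ]; ring
      rw [e1, e2, hθ, hudef, hB]
      push_cast
      ring
    have := mul_left_cancel₀ hκ0 this
    linarith
  have hτ : p * (u - B) + q * B = -a := by
    rw [hudef, hB]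
    linear_combination (-a) * hkl
  have huR : (0 : ℝ) ≤ u := by exact_mod_cast hu
  have hB0 : 0 ≤ B := by
    have : (-1 : ℝ) < B := by nlinarith
    have : (-1 : ℤ) < B := by exact_mod_cast this
    omega
  have hA0 : 0 ≤ u - B := by
    have : (-1 : ℝ) < u - B := by nlinarith
    have : (-1 : ℤ) < u - B := by exact_mod_cast this
    omega
  rcases hu.eq_or_lt with h0 | hpos
  · have hu0 : u = 0 := h0.symm
    have hBz : B = 0 := by omega
    have haz : a = 0 := by rw [hu0, hBz] at hτ; simpa using hτ
    refine ⟨?_, by omega⟩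
    rw [key, hu0, hBz]; simp
  · exfalso
    have hu1 : (1 : ℝ) ≤ u := by exact_mod_cast hpos
    split_ifs at hj' with hc
    · have hA1 : 1 ≤ u - B := by
        have : (0 : ℝ) < u - B := by nlinarith
        have : (0 : ℤ) < u - B := by exact_mod_cast this
        omega
      have : (p : ℤ) ≤ p * (u - B) := by nlinarith
      have : 0 ≤ (q : ℤ) * B := by positivity
      omega
    · have hB1 : 1 ≤ B := by
        have : (0 : ℝ) < B := by nlinarith
        have : (0 : ℤ) < B := by exact_mod_cast this
        omega
      have : (q : ℤ) ≤ q * B := by nlinarith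
      have : 0 ≤ (p : ℤ) * (u - B) := by positivity
      omega

lemma arith_inj (p q : ℕ) (hp : 0 < p) (hq : 0 < q) (α κ θ : ℝ) (k l : ℤ)
    (hα0 : 0 < α) (hα1 : α < 1)
    (hkl : (p : ℤ) * l - q * k = 1) (hκ : κ * (p + (q - p) * α) = 1)
    (hθ : θ = κ * ((l - k) * α + k)) (x x' : ℝ) (hx0 : 0 ≤ x) (hx1 : x < 1)
    (hx0' : 0 ≤ x') (hx1' : x' < 1) (j j' : ℕ)
    (hj : (j : ℤ) < if x < 1 - α then (p : ℤ) else q)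
    (hj' : (j' : ℤ) < if x' < 1 - α then (p : ℤ) else q)
    (hf : Int.fract (x * κ + j * θ) = Int.fract (x' * κ + j' * θ)) : x = x' ∧ j = j' := by
  obtain ⟨b, hb⟩ := Int.fract_eq_fract.1 hf
  rcases le_total 0 (b * (q - p) - ((j : ℤ) - j') * (l - k)) with h | h
  · exact arith_inj_aux p q hp hq α κ θ k l hα0 hα1 hkl hκ hθ x x' hx0 hx1 hx0' hx1' j j' hj' b hb h
  · obtain ⟨h1, h2⟩ := arith_inj_aux p q hp hq α κ θ k l hα0 hα1 hkl hκ hθ x' x hx0' hx1' hx0 hx1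
      j' j hj (-b) (by push_cast; linarith) (by linarith)
    exact ⟨h1.symm, h2.symm⟩

lemma arith_surj (p q : ℕ) (hp : 0 < p) (hq : 0 < q) (α κ θ : ℝ) (k l : ℤ)
    (hα0 : 0 < α) (hα1 : α < 1)
    (hkl : (p : ℤ) * l - q * k = 1) (hκ : κ * (p + (q - p) * α) = 1)
    (hθ : θ = κ * ((l - k) * α + k)) (w : ℝ) (hw0 : 0 ≤ w) (hw1 : w < 1) :
    ∃ x : ℝ, 0 ≤ x ∧ x < 1 ∧ ∃ j : ℕ, ((j : ℤ) < if x < 1 - α then (p : ℤ) else q) ∧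
      Int.fract (x * κ + j * θ) = w := by
  have hklR : (p : ℝ) * l - q * k = 1 := by exact_mod_cast hkl
  set y0 : ℝ := w * (p + (q - p) * α) with hy0
  set B : ℤ → ℤ := fun u => ⌊y0 + u * α⌋ with hB
  set τ : ℤ → ℤ := fun u => p * (u - B u) + q * B u with hτ
  have hstep : ∀ u, τ (u + 1) = τ u + if Int.fract (y0 + u * α) < 1 - α then (p : ℤ) else q := by
    intro u
    have e : y0 + (u + 1 : ℤ) * α = Int.fract (y0 + u * α) + α + (B u : ℤ) := by
      have := Int.fract_add_floor (y0 + u * α)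
      simp only [hB]; push_cast; linarith
    have f0 := Int.fract_nonneg (y0 + u * α)
    have f1 := Int.fract_lt_one (y0 + u * α)
    split_ifs with hc
    · have : B (u + 1) = B u := by
        have : ⌊y0 + (u + 1 : ℤ) * α⌋ = B u := by
          rw [e, Int.floor_eq_iff]; constructor <;> linarith
        exact this
      simp only [hτ, this]; ring
    · have : B (u + 1) = B u + 1 := by
        have : ⌊y0 + (u + 1 : ℤ) * α⌋ = B u + 1 := by
          rw [e, Int.floor_eq_iff]; push_cast; constructor <;> linarith
        exact this
      simp only [hτ, this]; ring
  have hmono : Monotone (fun u => τ u - u) := by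
    apply monotone_int_of_le_succ
    intro u
    have := hstep u
    split_ifs at this <;> omega
  obtain ⟨u, hu, hmax⟩ := Int.exists_greatest_of_bdd (P := fun u => τ u ≤ 0)
    ⟨max 0 (-τ 0), by
      intro z hz
      by_contra hc
      push Not at hc
      have h0z : 0 ≤ z := le_of_lt (lt_of_le_of_lt (le_max_left _ _) hc)
      have := hmono h0z
      have := lt_of_le_of_lt (le_max_right _ _) hc
      simp only at *
      omega⟩
    ⟨min 0 (-τ 0), by
      have := hmono (min_le_left 0 (-τ 0))
      have := min_le_right 0 (-τ 0)
      simp only at *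
      omega⟩
  refine ⟨Int.fract (y0 + u * α), Int.fract_nonneg _, Int.fract_lt_one _, (-τ u).toNat, ?_, ?_⟩
  · have h1 : 0 < τ (u + 1) := by
      by_contra hc
      have := hmax (u + 1) (by omega)
      omega
    rw [hstep u] at h1
    rw [Int.toNat_of_nonneg (by omega)]
    omega
  · have e : (((-τ u).toNat : ℕ) : ℝ) = -(τ u : ℝ) := by
      have : (((-τ u).toNat : ℕ) : ℤ) = -τ u := Int.toNat_of_nonneg (by omega)
      exact_mod_cast this
    rw [e]
    have ex : Int.fract (y0 + u * α) = y0 + u * α - B u := by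
      rw [Int.fract]
    have ew : Int.fract (y0 + u * α) * κ + -(τ u : ℝ) * θ = w + ((-(u * k) + B u * (k - l) : ℤ) : ℝ) := by
      have hp' : (p : ℝ) * θ = α * κ + k := by
        rw [hθ]; linear_combination κ * α * hklR + k * hκ
      have hq' : (q : ℝ) * θ = (α - 1) * κ + l := by
        rw [hθ]; linear_combination (κ * α - κ) * hklR + l * hκ
      rw [ex, hy0, hτ]
      push_cast
      linear_combination w * hκ + (-(u - B u : ℝ)) * hp' - B u * hq'
    rw [ew, Int.fract_add_intCast, Int.fract_eq_self.2 ⟨hw0, hw1⟩]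

lemma theta_irrational (p q : ℕ) (hp : 0 < p) (α κ θ : ℝ) (k l : ℤ)
    (hkl : (p : ℤ) * l - q * k = 1) (hκ : κ * (p + (q - p) * α) = 1)
    (hθ : θ = κ * ((l - k) * α + k)) (hα : Irrational α) : Irrational θ := by
  have hklR : (p : ℝ) * l - q * k = 1 := by exact_mod_cast hkl
  rintro ⟨r, hr⟩
  have hp' : (p : ℝ) * θ = α * κ + k := by
    rw [hθ]; linear_combination κ * α * hklR + k * hκ
  have h1 : α = (p * θ - k) * (p + (q - p) * α) := by
    rw [hp']; linear_combination (-α) * hκ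
  rw [← hr] at h1
  set s : ℚ := p * r - k with hs
  have h2 : α * ((1 - s * (q - p) : ℚ) : ℝ) = ((s * p : ℚ) : ℝ) := by
    rw [hs]; push_cast; linear_combination h1
  by_cases hz : (1 - s * (q - p) : ℚ) = 0
  · rw [hz] at h2
    have h3 : (s * p : ℚ) = 0 := by
      have : ((s * p : ℚ) : ℝ) = 0 := by rw [← h2]; simp
      exact_mod_cast this
    have hp0 : (p : ℚ) ≠ 0 := by exact_mod_cast hp.ne'
    have : s = 0 := by
      rcases mul_eq_zero.1 h3 with h | h
      · exact h
      · exact absurd h hp0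
    rw [this] at hz
    norm_num at hz
  · apply hα
    refine ⟨s * p / (1 - s * (q - p)), ?_⟩
    have hz' : ((1 - s * (q - p) : ℚ) : ℝ) ≠ 0 := by exact_mod_cast hz
    rw [Rat.cast_div, ← h2]
    field_simp

lemma rot_iterate (R : ℝ → ℝ) (α : ℝ) (h : ∀ x ∈ unitI, R x = Int.fract (x + α)) (x : ℝ)
    (hx : x ∈ unitI) (n : ℕ) : R^[n] x = Int.fract (x + n * α) := by
  induction n with
  | zero => simpa using (Int.fract_eq_self.2 hx).symm
  | succ n ih =>
    rw [Function.iterate_succ_apply', ih, h _ ⟨Int.fract_nonneg _, Int.fract_lt_one _⟩]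
    rw [Int.fract_eq_fract]
    refine ⟨-⌊x + n * α⌋, ?_⟩
    rw [Int.fract]; push_cast; ring

lemma irrational_of_minimal (S : ℝ → ℝ) (α : ℝ) (ho : ∀ x, x ∉ unitI → S x = x)
    (h : ∀ x ∈ unitI, S x = Int.fract (x + α)) (hmin : IsMinimal S) : Irrational α := by
  rintro ⟨r, hr⟩
  have h0 : (0 : ℝ) ∈ unitI := by simp [unitI]
  set b : ℝ := (r.den : ℝ) with hb
  have hb1 : (1 : ℝ) ≤ b := by
    have : 1 ≤ r.den := r.den_pos
    rw [hb]
    exact_mod_cast this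
  have hbα : b * α = r.num := by
    rw [← hr, hb]
    have := Rat.mul_den_eq_num r
    have h2 : ((r * r.den : ℚ) : ℝ) = ((r.num : ℚ) : ℝ) := by rw [this]
    push_cast at h2
    linarith
  have hcl : IsClosed ((fun y : ℝ => b * y) ⁻¹' (range ((↑) : ℤ → ℝ))) :=
    Int.isClosedEmbedding_coe_real.isClosed_range.preimage (by fun_prop)
  have hsub : orbitZ S 0 ⊆ (fun y : ℝ => b * y) ⁻¹' (range ((↑) : ℤ → ℝ)) := by
    rintro y ⟨n, hn | hn⟩
    · rw [rot_iterate S α h 0 h0, Int.fract] at hn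
      refine ⟨n * r.num - r.den * ⌊0 + n * α⌋, ?_⟩
      push_cast
      rw [← hn, ← hbα]
      ring
    · by_cases hy : y ∈ unitI
      · rw [rot_iterate S α h y hy, Int.fract] at hn
        refine ⟨r.den * ⌊y + n * α⌋ - n * r.num, ?_⟩
        push_cast
        rw [← hbα, ← hb]
        linear_combination (-b) * hn
      · exfalso
        have : ∀ n : ℕ, S^[n] y = y := fun n => Function.iterate_fixed (ho y hy) n
        rw [this] at hn
        exact hy (hn ▸ h0)
  have hmem : (1 / (2 * b)) ∈ unitI := by
    refine ⟨by positivity, ?_⟩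
    rw [div_lt_one (by positivity)]; linarith
  have := (closure_minimal hsub hcl) (hmin 0 h0 hmem)
  obtain ⟨z, hz⟩ := this
  have hz' : (z : ℝ) * 2 = 1 := by
    rw [hz]; field_simp
  have : z * 2 = 1 := by exact_mod_cast hz'
  omega

lemma minimal_of_irrational (R : ℝ → ℝ) (α : ℝ) 
    (h : ∀ x ∈ unitI, R x = Int.fract (x + α)) (hα : Irrational α) : IsMinimal R := by
  intro x hx y hy
  have hd : Dense (AddSubgroup.closure {α, 1} : Set ℝ) :=
    dense_addSubgroupClosure_pair_iff.2 (by simpa using hα)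
  rw [Metric.mem_closure_iff]
  intro ε hε
  have hlt : y - x < min (y + ε) 1 - x := by
    have : y < min (y + ε) 1 := lt_min (by linarith) hy.2
    linarith
  obtain ⟨s, hs, hs1, hs2⟩ := hd.exists_between hlt
  obtain ⟨k, l, hkl⟩ := AddSubgroup.mem_closure_pair.1 hs
  have hkl' : s = k * α + l := by rw [← hkl]; simp
  have hz1 : y < x + s := by linarith
  have hz2 : x + s < min (y + ε) 1 := by linarith
  have hz3 := lt_of_lt_of_le hz2 (min_le_left _ _)
  have hz4 := lt_of_lt_of_le hz2 (min_le_right _ _)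
  have hzI : x + s ∈ unitI := ⟨by linarith [hy.1], hz4⟩
  refine ⟨x + s, ?_, ?_⟩
  · rcases le_total 0 k with hk | hk
    · refine ⟨k.toNat, Or.inl ?_⟩
      rw [rot_iterate R α h x hx]
      have e : ((k.toNat : ℕ) : ℝ) = k := by exact_mod_cast Int.toNat_of_nonneg hk
      rw [e, ← Int.fract_eq_self.2 hzI, Int.fract_eq_fract]
      exact ⟨-l, by rw [hkl']; push_cast; ring⟩
    · refine ⟨(-k).toNat, Or.inr ?_⟩
      rw [rot_iterate R α h _ hzI]
      have e : (((-k).toNat : ℕ) : ℝ) = -k := by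
        exact_mod_cast Int.toNat_of_nonneg (by omega : 0 ≤ -k)
      rw [e]
      conv_rhs => rw [← Int.fract_eq_self.2 hx]
      rw [Int.fract_eq_fract]
      exact ⟨l, by rw [hkl']; push_cast; ring⟩
  · rw [Real.dist_eq, abs_lt]; constructor <;> linarith

/-- The standard rotation. -/
noncomputable def rotMap (α : ℝ) : ℝ → ℝ := fun x =>
  if x < 0 ∨ 1 ≤ x then x else if x < 1 - α then x + α else x + α - 1

lemma not_mem_unitI {x : ℝ} (hx : x ∉ unitI) : x < 0 ∨ 1 ≤ x := by
  simp only [unitI, mem_Ico, not_and_or, not_le, not_lt] at hx; exact hx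

lemma rotMap_fract (α : ℝ) (h0 : 0 < α) (h1 : α < 1) : ∀ x ∈ unitI, rotMap α x = Int.fract (x + α) := by
  rintro x ⟨hx0, hx1⟩
  symm
  rw [Int.fract_eq_iff]
  unfold rotMap
  rw [if_neg (by rintro (h | h) <;> linarith)]
  split_ifs with h
  · exact ⟨by linarith, by linarith, 0, by simp⟩
  · exact ⟨by linarith, by linarith, 1, by simp⟩

lemma rotMap_isIET (α : ℝ) (h0 : 0 < α) (h1 : α < 1) : IsIET (rotMap α) := by
  apply isIET_of_pieces _ _ _ {1 - α, 1}
  · rintro y ⟨hy0, hy1⟩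
    by_cases hc : y < 1 - α
    · refine ⟨1 - α, by simp, hc, α, fun x hx => ?_⟩
      unfold rotMap
      rw [if_neg (by rintro (h | h) <;> linarith [hx.1, hx.2]), if_pos hx.2]
    · refine ⟨1, by simp, hy1, α - 1, fun x hx => ?_⟩
      unfold rotMap
      rw [if_neg (by rintro (h | h) <;> linarith [hx.1, hx.2]), if_neg (by linarith [hx.1])]
      ring
  · refine ⟨?_, ?_, ?_⟩
    · rintro x ⟨hx0, hx1⟩
      unfold rotMap unitI
      rw [mem_Ico]
      split_ifs <;> constructor <;> linarith
    · rintro x ⟨hx0, hx1⟩ y ⟨hy0, hy1⟩ hxy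
      unfold rotMap at hxy
      split_ifs at hxy <;> grind
    · rintro y ⟨hy0, hy1⟩
      by_cases hc : y < α
      · refine ⟨y - α + 1, ⟨by linarith, by linarith⟩, ?_⟩
        unfold rotMap
        split_ifs <;> grind
      · refine ⟨y - α, ⟨by linarith, by linarith⟩, ?_⟩
        unfold rotMap
        split_ifs <;> grind
  · intro x hx
    unfold rotMap
    rw [if_pos (not_mem_unitI hx)]

/-- Standard constant-height tower: `δ = 1/d`, `η = δ * α`. -/
noncomputable def towMap (δ η : ℝ) : ℝ → ℝ := fun x =>
  if x < 0 ∨ 1 ≤ x then x else if x < 1 - δ then x + δ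
    else if x < 1 - η then x - 1 + δ + η else x - 1 + η

lemma towMap_isIET (δ η : ℝ) (h0 : 0 < η) (h1 : η < δ) (h2 : δ ≤ 1) : IsIET (towMap δ η) := by
  apply isIET_of_pieces _ _ _ {1 - δ, 1 - η, 1}
  · rintro y ⟨hy0, hy1⟩
    by_cases hc : y < 1 - δ
    · refine ⟨1 - δ, by simp, hc, δ, fun x hx => ?_⟩
      unfold towMap
      rw [if_neg (by rintro (h | h) <;> linarith [hx.1, hx.2]), if_pos hx.2]
    by_cases hc' : y < 1 - η
    · refine ⟨1 - η, by simp, hc', δ + η - 1, fun x hx => ?_⟩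
      unfold towMap
      rw [if_neg (by rintro (h | h) <;> linarith [hx.1, hx.2]), if_neg (by linarith [hx.1]),
        if_pos hx.2]
      ring
    · refine ⟨1, by simp, hy1, η - 1, fun x hx => ?_⟩
      unfold towMap
      rw [if_neg (by rintro (h | h) <;> linarith [hx.1, hx.2]), if_neg (by linarith [hx.1]),
        if_neg (by linarith [hx.1])]
      ring
  · refine ⟨?_, ?_, ?_⟩
    · rintro x ⟨hx0, hx1⟩
      unfold towMap unitI
      rw [mem_Ico]
      split_ifs <;> constructor <;> linarith
    · rintro x ⟨hx0, hx1⟩ y ⟨hy0, hy1⟩ hxy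
      unfold towMap at hxy
      split_ifs at hxy <;> grind
    · rintro y ⟨hy0, hy1⟩
      by_cases hc : y < η
      · refine ⟨y - η + 1, ⟨by linarith, by linarith⟩, ?_⟩
        unfold towMap
        split_ifs <;> grind
      by_cases hc' : y < δ
      · refine ⟨y - η - δ + 1, ⟨by linarith, by linarith⟩, ?_⟩
        unfold towMap
        split_ifs <;> grind
      · refine ⟨y - δ, ⟨by linarith, by linarith⟩, ?_⟩
        unfold towMap
        split_ifs <;> grind
  · intro x hx
    unfold towMap
    rw [if_pos (not_mem_unitI hx)]

lemma towMap_low (d : ℕ) (δ α : ℝ) (hδ : d * δ = 1) (hδ0 : 0 < δ)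
    (e : ℕ) (he : e + 1 < d) (w : ℝ) (hw0 : 0 ≤ w) (hw1 : w < 1) :
    towMap δ (δ * α) ((e + w) * δ) = ((e + 1 : ℕ) + w) * δ := by
  have he' : (e : ℝ) + 2 ≤ d := by exact_mod_cast he
  have h1 : (e + w) * δ < 1 - δ := by nlinarith
  have h2 : 0 ≤ (e + w) * δ := by positivity
  unfold towMap
  rw [if_neg (by rintro (h | h) <;> linarith), if_pos h1]
  push_cast; ring

lemma towMap_top (d : ℕ) (δ α : ℝ) (hδ : d * δ = 1) (hδ0 : 0 < δ) (h0 : 0 < α) (h1 : α < 1)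
    (e : ℕ) (he : e + 1 = d) (w : ℝ) (hw0 : 0 ≤ w) (hw1 : w < 1) :
    towMap δ (δ * α) ((e + w) * δ) = rotMap α w * δ := by
  have he' : (e : ℝ) = d - 1 := by rw [← he]; push_cast; ring
  have h2 : (e + w) * δ = 1 - δ + w * δ := by rw [he']; linear_combination hδ
  have h3 : 0 ≤ (e + w) * δ := by positivity
  have h4 : 0 ≤ w * δ := by positivity
  rw [h2] at h3 ⊢
  have h5 : w * δ < δ := by nlinarith
  by_cases hc : w < 1 - α
  · have hc' : w * δ < δ - δ * α := by nlinarith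
    unfold towMap
    rw [if_neg (by rintro (h | h) <;> linarith), if_neg (by linarith), if_pos (by linarith)]
    unfold rotMap
    rw [if_neg (by rintro (h | h) <;> linarith), if_pos hc]
    ring
  · have hc' : δ - δ * α ≤ w * δ := by nlinarith
    unfold towMap
    rw [if_neg (by rintro (h | h) <;> linarith), if_neg (by linarith), if_neg (by linarith)]
    unfold rotMap
    rw [if_neg (by rintro (h | h) <;> linarith), if_neg hc]
    ring

lemma towMap_isTower (d : ℕ) (δ α : ℝ) (hd : 0 < d) (hδ : d * δ = 1) (hδ0 : 0 < δ) (h0 : 0 < α)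
    (h1 : α < 1) : IsTowerOver (towMap δ (δ * α)) ![d, d] (rotMap α) := by
  have hd' : (1 : ℝ) ≤ d := by exact_mod_cast hd
  have hn : ∀ i : Fin 2, (![d, d] : Fin 2 → ℕ) i = d := by intro i; fin_cases i <;> rfl
  set t : Fin 3 → ℝ := ![0, 1 - α, 1] with ht
  have hti : ∀ i : Fin 2, 0 ≤ t i.castSucc ∧ t i.castSucc < t i.succ ∧ t i.succ ≤ 1 := by
    intro i; fin_cases i <;> simp [ht, h0.le, h1, h0, h1.le]
  have hlev : ∀ (i : Fin 2) (j : ℕ) (y : ℝ),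
      y ∈ Ico (j * δ + δ * t i.castSucc) (j * δ + δ * t i.castSucc + δ * (t i.succ - t i.castSucc)) ↔
      y * d ∈ Ico (j + t i.castSucc) (j + t i.succ) := by
    intro i j y
    have hy : y = y * d * δ := by linear_combination (-y) * hδ
    generalize y * d = z at hy
    subst hy
    simp only [mem_Ico]
    constructor
    · rintro ⟨ha, hb⟩
      constructor
      · apply le_of_mul_le_mul_right _ hδ0; linarith
      · apply lt_of_mul_lt_mul_right _ hδ0.le; linarith
    · rintro ⟨ha, hb⟩
      constructor <;> nlinarith
  have hfl : ∀ (i : Fin 2) (j : ℕ) (z : ℝ), z ∈ Ico (j + t i.castSucc) (j + t i.succ) → ⌊z⌋ = j := by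
    intro i j z hz
    have := hti i
    rw [Int.floor_eq_iff]
    push_cast
    constructor <;> linarith [hz.1, hz.2]
  refine ⟨towMap_isIET δ (δ * α) (by positivity) (by nlinarith) (by nlinarith), rotMap_isIET α h0 h1,
    fun i => by rw [hn]; exact hd, t, δ, fun i j => j * δ + δ * t i.castSucc, ?_, by simp [ht], by simp [ht, Fin.last],
    hδ0, ?_, ?_, ?_, ?_, ?_, ?_⟩
  · rw [Fin.strictMono_iff_lt_succ]
    intro i; exact (hti i).2.1
  · intro i
    fin_cases i
    · refine ⟨α, fun x hx => ?_⟩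
      simp [ht] at hx
      unfold rotMap
      rw [if_neg (by rintro (h | h) <;> linarith [hx.1, hx.2]), if_pos (by linarith)]
    · refine ⟨α - 1, fun x hx => ?_⟩
      simp [ht] at hx
      unfold rotMap
      rw [if_neg (by rintro (h | h) <;> linarith [hx.1, hx.2]), if_neg (by linarith)]
      ring
  · intro i j hj y hy
    rw [hn] at hj
    rw [hlev] at hy
    have := hti i
    have hj' : (j : ℝ) + 1 ≤ d := by exact_mod_cast hj
    have hj0 : (0 : ℝ) ≤ j := by positivity
    constructor
    · by_contra hc
      push Not at hc
      nlinarith [hy.1]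
    · by_contra hc
      push Not at hc
      nlinarith [hy.2]
  · intro i i' j j' hj hj' hne
    rw [Set.disjoint_left]
    intro y hy hy'
    rw [hlev] at hy hy'
    have e1 := hfl _ _ _ hy
    have e2 := hfl _ _ _ hy'
    have ej : j = j' := by rw [e1] at e2; exact_mod_cast e2
    subst ej
    apply hne
    have hii : i = i' := by
      fin_cases i <;> fin_cases i' <;> simp [ht] at hy hy' ⊢ <;> linarith [hy.1, hy.2, hy'.1, hy'.2]
    rw [hii]
  · rintro y ⟨hy0, hy1⟩
    have hyd : 0 ≤ y * d := by positivity
    have hfl0 : 0 ≤ ⌊y * d⌋ := Int.floor_nonneg.2 hyd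
    have hc : ((⌊y * d⌋.toNat : ℕ) : ℝ) = ⌊y * d⌋ := by exact_mod_cast Int.toNat_of_nonneg hfl0
    have hj : ⌊y * d⌋.toNat < d := by
      have : ((⌊y * d⌋.toNat : ℕ) : ℝ) < d := by
        rw [hc]
        have := Int.floor_le (y * d)
        nlinarith
      exact_mod_cast this
    have a1 := Int.floor_le (y * d)
    have a2 := Int.lt_floor_add_one (y * d)
    by_cases hcs : y * d < ⌊y * d⌋ + (1 - α)
    · refine ⟨0, ⌊y * d⌋.toNat, by simpa [hn] using hj, ?_⟩
      rw [hlev, hc]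
      simp [ht]
      constructor <;> linarith
    · refine ⟨1, ⌊y * d⌋.toNat, by simpa [hn] using hj, ?_⟩
      rw [hlev, hc]
      have e1 : t (1 : Fin 2).castSucc = 1 - α := by simp [ht]
      have e2 : t (1 : Fin 2).succ = 1 := by simp [ht]
      rw [e1, e2]
      refine ⟨?_, ?_⟩ <;> linarith
  · intro i j hj x hx
    rw [hn] at hj
    have := hti i
    have := towMap_low d δ α hδ hδ0 j hj x (by linarith [hx.1]) (by linarith [hx.2])
    simp only
    rw [show (j : ℝ) * δ + δ * t i.castSucc + δ * (x - t i.castSucc) = (j + x) * δ by ring, this]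
    ring
  · intro i x hx i' hi'
    have := hti i
    have := towMap_top d δ α hδ hδ0 h0 h1 (d - 1) (by omega) x (by linarith [hx.1]) (by linarith [hx.2])
    rw [hn]
    simp only
    rw [show ((d - 1 : ℕ) : ℝ) * δ + δ * t i.castSucc + δ * (x - t i.castSucc)
      = ((d - 1 : ℕ) + x) * δ by ring, this]
    push_cast
    ring

lemma tower_measure (n : Fin 2 → ℕ) (a : Fin 2 → ℕ → ℝ) (len : Fin 2 → ℝ) (hlen : ∀ i, 0 ≤ len i)
    (hsub : ∀ i : Fin 2, ∀ j : ℕ, j < n i → Ico (a i j) (a i j + len i) ⊆ unitI)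
    (hdis : ∀ i i' : Fin 2, ∀ j j' : ℕ, j < n i → j' < n i' → (i, j) ≠ (i', j') →
      Disjoint (Ico (a i j) (a i j + len i)) (Ico (a i' j') (a i' j' + len i')))
    (hcov : ∀ y ∈ unitI, ∃ (i : Fin 2) (j : ℕ), j < n i ∧ y ∈ Ico (a i j) (a i j + len i)) :
    n 0 * len 0 + n 1 * len 1 = 1 := by
  classical
  let s : Finset (Σ _ : Fin 2, ℕ) := Finset.univ.sigma (fun i => Finset.range (n i))
  let f : (Σ _ : Fin 2, ℕ) → Set ℝ := fun z => Ico (a z.1 z.2) (a z.1 z.2 + len z.1)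
  have hU : unitI = ⋃ z ∈ s, f z := by
    ext y
    simp only [mem_iUnion]
    constructor
    · intro hy
      obtain ⟨i, j, hj, hyy⟩ := hcov y hy
      exact ⟨⟨i, j⟩, by simpa [s] using hj, hyy⟩
    · rintro ⟨⟨i, j⟩, hz, hy⟩
      exact hsub i j (by simpa [s] using hz) hy
  have hm := MeasureTheory.measure_biUnion_finset (μ := MeasureTheory.volume) (s := s) (f := f)
    (by
      rintro ⟨i, j⟩ hz ⟨i', j'⟩ hz' hne
      have hz1 : j < n i := by simpa [s] using hz
      have hz2 : j' < n i' := by simpa [s] using hz'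
      exact hdis i i' j j' hz1 hz2 (by
        intro h
        apply hne
        rw [Prod.mk.injEq] at h
        obtain ⟨h1, h2⟩ := h
        subst h1 h2
        rfl))
    (fun z _ => measurableSet_Ico)
  rw [← hU] at hm
  simp only [unitI, f, Real.volume_Ico, s, Finset.sum_sigma, Fin.sum_univ_two, add_sub_cancel_left,
    Finset.sum_const, Finset.card_range, sub_zero] at hm
  rw [nsmul_eq_mul, nsmul_eq_mul, ← ENNReal.ofReal_natCast, ← ENNReal.ofReal_natCast,
    ← ENNReal.ofReal_mul (by positivity), ← ENNReal.ofReal_mul (by positivity),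
    ← ENNReal.ofReal_add (mul_nonneg (by positivity) (hlen 0)) (mul_nonneg (by positivity) (hlen 1))] at hm
  have h1 := congrArg ENNReal.toReal hm
  rw [ENNReal.toReal_ofReal (by norm_num), ENNReal.toReal_ofReal
    (add_nonneg (mul_nonneg (by positivity) (hlen 0)) (mul_nonneg (by positivity) (hlen 1)))] at h1
  exact h1.symm

lemma nat_split {e e' : ℕ} {w w' : ℝ} {δ : ℝ} (hδ : 0 < δ)
    (hw : 0 ≤ w ∧ w < 1) (hw' : 0 ≤ w' ∧ w' < 1) (h : ((e : ℝ) + w) * δ = (e' + w') * δ) :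
    e = e' ∧ w = w' := by
  have h1 := mul_right_cancel₀ hδ.ne' h
  have h2 : ⌊(e : ℝ) + w⌋ = e := by
    rw [Int.floor_eq_iff]; push_cast; constructor <;> linarith [hw.1, hw.2]
  have h3 : ⌊(e' : ℝ) + w'⌋ = e' := by
    rw [Int.floor_eq_iff]; push_cast; constructor <;> linarith [hw'.1, hw'.2]
  rw [h1, h3] at h2
  have h4 : e = e' := by exact_mod_cast h2.symm
  subst h4
  exact ⟨rfl, by linarith⟩

set_option maxHeartbeats 4000000 in
theorem stmt5 (T S : ℝ → ℝ) (m n : ℕ)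
    (hS : IsRotation S) (hSmin : IsMinimal S)
    (hT : IsTowerOver T ![m, n] S)
    (d : ℕ) (hd : d = Nat.gcd m n) (hd1 : 1 < d) :
    ∃ (R T' : ℝ → ℝ), IsRotation R ∧ IsMinimal R ∧
      IsTowerOver T' ![d, d] R ∧ IsConjugate T T' := by
  classical
  obtain ⟨hSo, α, ⟨hα0, hα1⟩, hSα⟩ := hS
  have hirr := irrational_of_minimal S α hSo hSα hSmin
  obtain ⟨hTI, hSI, hNpos, t, c, a, htm, ht0, ht2, hc0, htr, hsub, hdis, hcov, hup, htop⟩ := hT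
  have hd0 : 0 < d := by omega
  obtain ⟨p, hp⟩ : d ∣ m := hd ▸ Nat.gcd_dvd_left m n
  obtain ⟨q, hq⟩ : d ∣ n := hd ▸ Nat.gcd_dvd_right m n
  have hm0 : 0 < m := hNpos 0
  have hn0 : 0 < n := hNpos 1
  have hp0 : 0 < p := by rcases Nat.eq_zero_or_pos p with h | h; · simp [h] at hp; omega
                         · exact h
  have hq0 : 0 < q := by rcases Nat.eq_zero_or_pos q with h | h; · simp [h] at hq; omega
                         · exact h
  have hcop : Nat.Coprime p q := by
    have : d * Nat.gcd p q = d * 1 := by rw [← Nat.gcd_mul_left, ← hp, ← hq, ← hd, mul_one]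
    exact Nat.eq_of_mul_eq_mul_left hd0 this
  obtain ⟨k, l, hkl⟩ : ∃ k l : ℤ, (p : ℤ) * l - q * k = 1 := by
    refine ⟨-Nat.gcdB p q, Nat.gcdA p q, ?_⟩
    have := Nat.gcd_eq_gcd_ab p q
    rw [hcop] at this
    push_cast at this
    linarith
  have hklR : (p : ℝ) * l - q * k = 1 := by exact_mod_cast hkl
  have ht01 : t 0 < t 1 := htm (by decide)
  have ht12 : t 1 < t 2 := htm (by decide)
  have ht2' : t 2 = 1 := ht2
  have htr0 : ∀ x ∈ Ico 0 (t 1), S x = x + α := by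
    obtain ⟨δ, hδ⟩ := htr 0
    have hδ' : ∀ x ∈ Ico (t 0) (t 1), S x = x + δ := hδ
    rw [ht0] at hδ'
    have e1 := hδ' 0 ⟨le_rfl, by linarith⟩
    rw [hSα 0 ⟨le_rfl, by norm_num⟩, zero_add, zero_add, Int.fract_eq_self.2 ⟨hα0.le, hα1⟩] at e1
    rw [e1]; exact hδ'
  have htr1 : ∀ x ∈ Ico (t 1) 1, S x = x + (α - 1) := by
    obtain ⟨δ, hδ⟩ := htr 1
    have hδ' : ∀ x ∈ Ico (t 1) (t 2), S x = x + δ := hδ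
    rw [ht2'] at hδ'
    set x := max (t 1) (1 - α) with hx
    have hx1 : x < 1 := max_lt (by linarith) (by linarith)
    have hxt : t 1 ≤ x := le_max_left _ _
    have hxa : 1 - α ≤ x := le_max_right _ _
    have e1 := hδ' x ⟨hxt, hx1⟩
    rw [hSα x ⟨by linarith, hx1⟩] at e1
    have : Int.fract (x + α) = x + α - 1 := by
      rw [Int.fract_eq_iff]; exact ⟨by linarith, by linarith, 1, by simp⟩
    have : δ = α - 1 := by linarith
    rw [← this]; exact hδ'
  have ht1 : t 1 = 1 - α := by
    apply le_antisymm
    · by_contra hc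
      push Not at hc
      have h1 := htr0 (1 - α) ⟨by linarith, hc⟩
      have h2 := (hSI.1.mapsTo (show (1 - α) ∈ unitI from ⟨by linarith, by linarith⟩)).2
      linarith
    · have h1 := htr1 (t 1) ⟨le_rfl, by linarith⟩
      have h2 := (hSI.1.mapsTo (show t 1 ∈ unitI from ⟨by linarith, by linarith⟩)).1
      linarith
  set N : Fin 2 → ℕ := ![m, n] with hN
  set H : Fin 2 → ℕ := ![p, q] with hH
  set tl : Fin 2 → ℝ := fun i => t i.castSucc with htl
  set tr : Fin 2 → ℝ := fun i => t i.succ with htrr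
  have tl0 : tl 0 = 0 := ht0
  have tr0 : tr 0 = 1 - α := ht1
  have tl1 : tl 1 = 1 - α := ht1
  have tr1 : tr 1 = 1 := ht2'
  have hNH : ∀ i, N i = d * H i := by
    intro i; fin_cases i
    · exact hp
    · exact hq
  have hlen : ∀ i, 0 < tr i - tl i := by
    intro i; fin_cases i
    · simp only [Fin.zero_eta, tl0, tr0]; linarith
    · simp only [Fin.mk_one, tl1, tr1]; linarith
  have htl0 : ∀ i, 0 ≤ tl i := by
    intro i; fin_cases i
    · simp only [Fin.zero_eta, tl0]; linarith
    · simp only [Fin.mk_one, tl1]; linarith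
  have htr1' : ∀ i, tr i ≤ 1 := by
    intro i; fin_cases i
    · simp only [Fin.zero_eta, tr0]; linarith
    · simp only [Fin.mk_one, tr1]; linarith
  have hHx : ∀ i, ∀ x ∈ Ico (tl i) (tr i), (if x < 1 - α then (p : ℤ) else q) = H i := by
    intro i x hx
    fin_cases i
    · simp only [Fin.zero_eta, tl0, tr0] at hx
      rw [if_pos hx.2]; rfl
    · simp only [Fin.mk_one, tl1, tr1] at hx
      rw [if_neg (by linarith [hx.1])]; rfl
  have hcolx : ∀ x ∈ unitI, ∃ i, x ∈ Ico (tl i) (tr i) := by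
    intro x hx
    by_cases h : x < 1 - α
    · exact ⟨0, by rw [tl0, tr0]; exact ⟨hx.1, h⟩⟩
    · exact ⟨1, by rw [tl1, tr1]; exact ⟨by linarith, hx.2⟩⟩
  have hcolu : ∀ i i' x, x ∈ Ico (tl i) (tr i) → x ∈ Ico (tl i') (tr i') → i = i' := by
    intro i i' x hx hx'
    fin_cases i <;> fin_cases i' <;>
      simp only [Fin.zero_eta, Fin.mk_one, tl0, tr0, tl1, tr1, mem_Ico] at hx hx' ⊢ <;>
      exfalso <;> linarith [hx.1, hx.2, hx'.1, hx'.2]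
  have hmeas : (m : ℝ) * (c * (1 - α)) + n * (c * α) = 1 := by
    have := tower_measure N a (fun i => c * (tr i - tl i)) (fun i => by
      have := hlen i; positivity) hsub hdis hcov
    simp only [tl0, tr0, tl1, tr1] at this
    have e0 : N 0 = m := rfl
    have e1 : N 1 = n := rfl
    rw [e0, e1] at this
    linarith
  set κ : ℝ := c * d with hκdef
  have hdR : (0 : ℝ) < d := by exact_mod_cast hd0
  have hκ0 : 0 < κ := by positivity
  have hκ : κ * (p + (q - p) * α) = 1 := by
    rw [hp, hq] at hmeas
    push_cast at hmeas
    rw [hκdef]; linarith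
  have hκ1 : κ ≤ 1 := by
    have h1 : (1 : ℝ) ≤ p := by exact_mod_cast hp0
    have h2 : (1 : ℝ) ≤ q := by exact_mod_cast hq0
    have : 1 ≤ (p + (q - p) * α : ℝ) := by nlinarith
    nlinarith
  set θ : ℝ := κ * ((l - k) * α + k) with hθ
  have hθirr := theta_irrational p q hp0 α κ θ k l hkl hκ hθ hirr
  have hpθ : (p : ℝ) * θ = α * κ + k := by
    rw [hθ]; linear_combination κ * α * hklR + k * hκ
  have hqθ : (q : ℝ) * θ = (α - 1) * κ + l := by
    rw [hθ]; linear_combination (κ * α - κ) * hklR + l * hκ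
  set θ' : ℝ := Int.fract θ with hθ'
  have hθ'irr : Irrational θ' := by
    rw [hθ', Int.fract]; exact hθirr.sub_intCast _
  have hθ'0 : 0 < θ' := lt_of_le_of_ne (Int.fract_nonneg _) (fun h => hθ'irr.ne_zero h.symm)
  have hθ'1 : θ' < 1 := Int.fract_lt_one _
  have hrot : ∀ z : ℝ, rotMap θ' (Int.fract z) = Int.fract (z + θ) := by
    intro z
    rw [rotMap_fract θ' hθ'0 hθ'1 _ ⟨Int.fract_nonneg _, Int.fract_lt_one _⟩, hθ', Int.fract_eq_fract]
    refine ⟨-⌊z⌋ - ⌊θ⌋, ?_⟩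
    rw [Int.fract, Int.fract]; push_cast; ring
  have hrotation : ∀ x ∈ unitI, rotMap θ' x = Int.fract (x + θ') := rotMap_fract θ' hθ'0 hθ'1
  set δ : ℝ := (d : ℝ)⁻¹ with hδ
  have hδ0 : 0 < δ := by positivity
  have hdδ : d * δ = 1 := mul_inv_cancel₀ hdR.ne'
  have hκδ : κ * δ = c := by rw [hκdef, mul_assoc, hdδ, mul_one]
  refine ⟨rotMap θ', towMap δ (δ * θ'), ⟨(rotMap_isIET θ' hθ'0 hθ'1).2.1, θ', ⟨hθ'0, hθ'1⟩, hrotation⟩,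
    minimal_of_irrational _ θ' hrotation hθ'irr, towMap_isTower d δ θ' hd0 hdδ hδ0 hθ'0 hθ'1, ?_⟩
  have hcov' : ∀ y ∈ unitI, ∃ (i : Fin 2) (j : ℕ) (x : ℝ), j < N i ∧ x ∈ Ico (tl i) (tr i) ∧
      y = a i j + c * (x - tl i) := by
    intro y hy
    obtain ⟨i, j, hj, hyy⟩ := hcov y hy
    refine ⟨i, j, tl i + (y - a i j) / c, hj, ⟨?_, ?_⟩, by field_simp; ring⟩
    · have : 0 ≤ (y - a i j) / c := div_nonneg (by linarith [hyy.1]) hc0.le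
      linarith
    · have : (y - a i j) / c < tr i - tl i := by
        rw [div_lt_iff₀ hc0]; linarith [hyy.2]
      linarith
  have hmemlev : ∀ i j x, x ∈ Ico (tl i) (tr i) →
      a i j + c * (x - tl i) ∈ Ico (a i j) (a i j + c * (tr i - tl i)) := by
    intro i j x hx
    constructor
    · have := mul_nonneg hc0.le (sub_nonneg.2 hx.1); linarith
    · have := mul_lt_mul_of_pos_left (sub_lt_sub_right hx.2 (tl i)) hc0; linarith
  let G : ℕ → ℝ → ℝ := fun j x => ((j % d : ℕ) + Int.fract (x * κ + (j / d : ℕ) * θ)) * δ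
  let g : ℝ → ℝ := fun y => if hy : y ∈ unitI then
    G (hcov' y hy).choose_spec.choose (hcov' y hy).choose_spec.choose_spec.choose else y
  have hg : ∀ i j x, j < N i → x ∈ Ico (tl i) (tr i) → g (a i j + c * (x - tl i)) = G j x := by
    intro i j x hj hx
    have hy : a i j + c * (x - tl i) ∈ unitI := hsub i j hj (hmemlev i j x hx)
    obtain ⟨h1, h2, h3⟩ := (hcov' _ hy).choose_spec.choose_spec.choose_spec
    have hgy : g (a i j + c * (x - tl i)) = G (hcov' _ hy).choose_spec.choose
      (hcov' _ hy).choose_spec.choose_spec.choose := dif_pos hy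
    rw [hgy]
    generalize (hcov' _ hy).choose_spec.choose_spec.choose = x' at *
    generalize (hcov' _ hy).choose_spec.choose = j' at *
    generalize (hcov' _ hy).choose = i' at *
    by_cases hij : (i, j) = (i', j')
    · rw [Prod.mk.injEq] at hij
      obtain ⟨rfl, rfl⟩ := hij
      have : c * (x - tl i) = c * (x' - tl i) := by linarith
      have := mul_left_cancel₀ hc0.ne' this
      have : x = x' := by linarith
      rw [this]
    · exfalso
      refine Set.disjoint_left.1 (hdis i i' j j' hj h1 hij) (hmemlev i j x hx) ?_
      rw [h3]; exact hmemlev i' j' x' h2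
  have hgo : ∀ y, y ∉ unitI → g y = y := fun y hy => dif_neg hy
  have hjd : ∀ i j, j < N i → j / d < H i := by
    intro i j hj
    rw [Nat.div_lt_iff_lt_mul hd0, mul_comm, ← hNH]; exact hj
  have hfr : ∀ z : ℝ, 0 ≤ Int.fract z ∧ Int.fract z < 1 :=
    fun z => ⟨Int.fract_nonneg _, Int.fract_lt_one _⟩
  have hgmaps : MapsTo g unitI unitI := by
    intro y hy
    obtain ⟨i, j, x, hj, hx, rfl⟩ := hcov' y hy
    rw [hg i j x hj hx]
    have h1 : (((j % d : ℕ) : ℝ)) + 1 ≤ d := by exact_mod_cast Nat.mod_lt j hd0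
    have h2 := hfr (x * κ + (j / d : ℕ) * θ)
    have h0 : (0 : ℝ) ≤ ((j % d : ℕ) : ℝ) := by positivity
    constructor
    · exact mul_nonneg (by linarith) hδ0.le
    · calc G j x < d * δ := mul_lt_mul_of_pos_right (by linarith) hδ0
        _ = 1 := hdδ
  have hginj : InjOn g unitI := by
    intro y hy y' hy' hyy
    obtain ⟨i, j, x, hj, hx, rfl⟩ := hcov' y hy
    obtain ⟨i', j', x', hj', hx', rfl⟩ := hcov' y' hy'
    rw [hg i j x hj hx, hg i' j' x' hj' hx'] at hyy
    obtain ⟨h1, h2⟩ := nat_split hδ0 (hfr _) (hfr _) hyy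
    obtain ⟨h3, h4⟩ := arith_inj p q hp0 hq0 α κ θ k l hα0 hα1 hkl hκ hθ x x'
      (by linarith [htl0 i, hx.1]) (by linarith [htr1' i, hx.2])
      (by linarith [htl0 i', hx'.1]) (by linarith [htr1' i', hx'.2]) (j / d) (j' / d)
      (by rw [hHx i x hx]; exact_mod_cast hjd i j hj)
      (by rw [hHx i' x' hx']; exact_mod_cast hjd i' j' hj') h2
    have h5 : j = j' := by rw [← Nat.div_add_mod j d, ← Nat.div_add_mod j' d, h1, h4]
    subst h3 h5
    have h6 := hcolu i i' x hx hx'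
    rw [h6]
  have hgsurj : SurjOn g unitI unitI := by
    rintro z ⟨hz0, hz1⟩
    have hzd : 0 ≤ z * d := by positivity
    have hfl0 : 0 ≤ ⌊z * d⌋ := Int.floor_nonneg.2 hzd
    obtain ⟨e, he⟩ := Int.eq_ofNat_of_zero_le hfl0
    have hed : e < d := by
      have h1 := Int.floor_le (z * d)
      rw [he] at h1
      have : (e : ℝ) < d := by
        push_cast at h1
        nlinarith
      exact_mod_cast this
    obtain ⟨x, hx0, hx1, j', hj', hfx⟩ := arith_surj p q hp0 hq0 α κ θ k l hα0 hα1 hkl hκ hθ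
      (Int.fract (z * d)) (Int.fract_nonneg _) (Int.fract_lt_one _)
    obtain ⟨i, hx⟩ := hcolx x ⟨hx0, hx1⟩
    rw [hHx i x hx] at hj'
    have hj'' : j' < H i := by exact_mod_cast hj'
    have hj : d * j' + e < N i := by
      rw [hNH]
      calc d * j' + e < d * j' + d := by omega
        _ = d * (j' + 1) := by ring
        _ ≤ d * H i := Nat.mul_le_mul_left d hj''
    refine ⟨a i (d * j' + e) + c * (x - tl i), hsub i _ hj (hmemlev i _ x hx), ?_⟩
    rw [hg i _ x hj hx]
    have e1 : (d * j' + e) % d = e := by rw [Nat.mul_add_mod, Nat.mod_eq_of_lt hed]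
    have e2 : (d * j' + e) / d = j' := by
      rw [Nat.mul_add_div hd0, Nat.div_eq_of_lt hed, add_zero]
    change (((d * j' + e) % d : ℕ) + Int.fract (x * κ + ((d * j' + e) / d : ℕ) * θ)) * δ = z
    rw [e1, e2, hfx, Int.fract, he]
    push_cast
    linear_combination z * hdδ
  have hgI : IsIET g := by
    let Z : Fin 2 → ℕ → ℤ := fun i j => ⌊tl i * κ + (j / d : ℕ) * θ⌋ + 1
    let E : Fin 2 → ℕ → ℝ := fun i j => a i j + c * (tr i - tl i)
    let P : Fin 2 → ℕ → ℝ := fun i j => a i j + c * ((Z i j - (j / d : ℕ) * θ) / κ - tl i)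
    let s : Finset (Σ _ : Fin 2, ℕ) := Finset.univ.sigma (fun i => Finset.range (N i))
    apply isIET_of_pieces g ⟨hgmaps, hginj, hgsurj⟩ hgo
      (s.image (fun z => E z.1 z.2) ∪ s.image (fun z => min (E z.1 z.2) (P z.1 z.2)))
    intro y hy
    obtain ⟨i, j, x, hj, hx, rfl⟩ := hcov' y hy
    have hs : (⟨i, j⟩ : Σ _ : Fin 2, ℕ) ∈ s := by simpa [s] using hj
    have main : ∀ v : ℝ, v ≤ E i j → ∀ f : ℤ, (∀ x' ∈ Ico x (tr i),
        a i j + c * (x' - tl i) < v → ⌊x' * κ + (j / d : ℕ) * θ⌋ = f) →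
        ∃ C, ∀ y ∈ Ico (a i j + c * (x - tl i)) v, g y = y + C := by
      intro v hv f hf
      refine ⟨((j % d : ℕ) + (j / d : ℕ) * θ - f) * δ + c * tl i - a i j, fun y hy => ?_⟩
      obtain ⟨x', rfl⟩ : ∃ x', y = a i j + c * (x' - tl i) :=
        ⟨tl i + (y - a i j) / c, by field_simp; ring⟩
      have hxx : x ≤ x' := by
        have := hy.1
        have := le_of_mul_le_mul_left (by linarith : c * (x - tl i) ≤ c * (x' - tl i)) hc0
        linarith
      have hxr : x' < tr i := by
        have := lt_of_lt_of_le hy.2 hv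
        simp only [E] at this
        have := lt_of_mul_lt_mul_left (by linarith : c * (x' - tl i) < c * (tr i - tl i)) hc0.le
        linarith
      rw [hg i j x' hj ⟨le_trans hx.1 hxx, hxr⟩]
      have hf' := hf x' ⟨hxx, hxr⟩ hy.2
      simp only [G]
      rw [Int.fract, hf', ← hκδ]
      ring
    have hfl1 := Int.floor_le (tl i * κ + (j / d : ℕ) * θ)
    have hfl2 := Int.lt_floor_add_one (tl i * κ + (j / d : ℕ) * θ)
    have hlow : ∀ x', x ≤ x' → tl i * κ ≤ x' * κ := fun x' h =>
      mul_le_mul_of_nonneg_right (le_trans hx.1 h) hκ0.le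
    have hEy : a i j + c * (x - tl i) < E i j := (hmemlev i j x hx).2
    have hZ : (Z i j : ℝ) = ⌊tl i * κ + (j / d : ℕ) * θ⌋ + 1 := by simp [Z]
    by_cases hcase : x * κ + (j / d : ℕ) * θ < Z i j
    · refine ⟨min (E i j) (P i j), Finset.mem_union_right _ (Finset.mem_image.2 ⟨_, hs, rfl⟩),
        lt_min hEy ?_, main _ (min_le_left _ _) (Z i j - 1) ?_⟩
      · simp only [P]
        have : x < (Z i j - (j / d : ℕ) * θ) / κ := by rw [lt_div_iff₀ hκ0]; linarith
        have := mul_lt_mul_of_pos_left (sub_lt_sub_right this (tl i)) hc0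
        linarith
      · intro x' hx' hlt
        have h1 := lt_of_lt_of_le hlt (min_le_right _ _)
        simp only [P] at h1
        have h2 := lt_of_mul_lt_mul_left (by linarith : c * (x' - tl i) <
          c * ((Z i j - (j / d : ℕ) * θ) / κ - tl i)) hc0.le
        have h3 : x' < (Z i j - (j / d : ℕ) * θ) / κ := by linarith
        rw [lt_div_iff₀ hκ0] at h3
        have := hlow x' hx'.1
        rw [Int.floor_eq_iff]
        push_cast
        constructor <;> linarith
    · refine ⟨E i j, Finset.mem_union_left _ (Finset.mem_image.2 ⟨_, hs, rfl⟩), hEy,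
        main _ le_rfl (Z i j) ?_⟩
      intro x' hx' _
      have h1 : x * κ ≤ x' * κ := mul_le_mul_of_nonneg_right hx'.1 hκ0.le
      have h2 : (x' - tl i) * κ < 1 := by
        have h3 : x' - tl i < 1 := by linarith [hx'.2, htr1' i, htl0 i]
        have h4 : 0 ≤ x' - tl i := by linarith [hx'.1, hx.1]
        nlinarith
      rw [Int.floor_eq_iff]
      constructor <;> linarith
  refine ⟨g, hgI, ?_⟩
  funext y
  simp only [Function.comp_apply]
  by_cases hy : y ∈ unitI
  swap
  · rw [hTI.2.1 y hy, hgo y hy, (towMap_isTower d δ θ' hd0 hdδ hδ0 hθ'0 hθ'1).1.2.1 y hy]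
  obtain ⟨i, j, x, hj, hx, rfl⟩ := hcov' y hy
  rw [hg i j x hj hx]
  have hmod := Nat.mod_lt j hd0
  have hdm := Nat.div_add_mod j d
  by_cases hj1 : j + 1 < N i
  · have e1 : T (a i j + c * (x - tl i)) = a i (j + 1) + c * (x - tl i) := hup i j hj1 x hx
    rw [e1, hg i (j + 1) x hj1 hx]
    by_cases he : j % d + 1 < d
    · simp only [G]
      rw [towMap_low d δ θ' hdδ hδ0 (j % d) he _ (hfr _).1 (hfr _).2]
      have e2 : (j + 1) % d = j % d + 1 := by
        conv_lhs => rw [← hdm, add_assoc, Nat.mul_add_mod, Nat.mod_eq_of_lt he]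
      have e3 : (j + 1) / d = j / d := by
        conv_lhs => rw [← hdm, add_assoc, Nat.mul_add_div hd0, Nat.div_eq_of_lt he, add_zero]
      rw [e2, e3]
    · have he' : j % d + 1 = d := by omega
      simp only [G]
      rw [towMap_top d δ θ' hdδ hδ0 hθ'0 hθ'1 (j % d) he' _ (hfr _).1 (hfr _).2, hrot]
      have e0 : j + 1 = d * (j / d + 1) := by rw [mul_add, mul_one]; omega
      have e2 : (j + 1) % d = 0 := by rw [e0, Nat.mul_mod_right]
      have e3 : (j + 1) / d = j / d + 1 := by
        conv_lhs => rw [e0, Nat.mul_div_cancel_left _ hd0]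
      rw [e2, e3]
      push_cast
      rw [zero_add]
      congr 2
      ring
  · have hjN : j = N i - 1 := by omega
    have hxI : x ∈ unitI := ⟨by linarith [htl0 i, hx.1], by linarith [htr1' i, hx.2]⟩
    obtain ⟨i', hi'⟩ := hcolx (S x) (hSI.1.mapsTo hxI)
    have e1 : T (a i j + c * (x - tl i)) = a i' 0 + c * (S x - tl i') := by
      rw [hjN]; exact htop i x hx i' hi'
    rw [e1, hg i' 0 (S x) (hNpos i') hi']
    have e0 : j + 1 = d * H i := by rw [← hNH]; omega
    have e2 : (j + 1) % d = 0 := by rw [e0, Nat.mul_mod_right]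
    have he' : j % d + 1 = d := by
      by_contra hne
      have he : j % d + 1 < d := by omega
      have : (j + 1) % d = j % d + 1 := by
        conv_lhs => rw [← hdm, add_assoc, Nat.mul_add_mod, Nat.mod_eq_of_lt he]
      omega
    have e3 : j / d + 1 = H i := by
      have : d * (j / d + 1) = d * H i := by rw [mul_add, mul_one, ← e0]; omega
      exact Nat.eq_of_mul_eq_mul_left hd0 this
    have e3R : ((j / d : ℕ) : ℝ) * θ + θ = H i * θ := by rw [← e3]; push_cast; ring
    simp only [G]
    rw [towMap_top d δ θ' hdδ hδ0 hθ'0 hθ'1 (j % d) he' _ (hfr _).1 (hfr _).2, hrot,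
      add_assoc, e3R, Nat.zero_mod, Nat.zero_div]
    push_cast
    rw [zero_add, zero_mul, add_zero]
    congr 1
    rw [Int.fract_eq_fract]
    rcases (by fin_cases i <;> simp : i = 0 ∨ i = 1) with rfl | rfl
    · rw [htr0 x ⟨hxI.1, hx.2⟩]
      refine ⟨-k, ?_⟩
      have : H 0 = p := rfl
      rw [this, hpθ]; push_cast; ring
    · rw [htr1 x ⟨hx.1, hxI.2⟩]
      refine ⟨-l, ?_⟩
      have : H 1 = q := rfl
      rw [this, hqθ]; push_cast; ring

end IETRoots
end

section
/- Every tower T of type (m,n) over a minimal rotation has an n-th root in 𝔾 for some n ≥ 2; that is, there exist an interval exchange transformation S and an integer k ≥ 2 with S^k = T. -/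
open Set

namespace IETRoots

section RootProof

/-- cell of the tower: column `col`, horizontal coordinate `x`, level `i` -/
def Dm (A : ℝ) (m n : ℤ) (col : Bool) (x : ℝ) (i : ℤ) : Prop :=
  (bif col then A else 0) ≤ x ∧ x < (bif col then 1 else A) ∧ 0 ≤ i ∧ i < (bif col then n else m)

lemma Dm_false {A : ℝ} {m n : ℤ} {x : ℝ} {i : ℤ} :
    Dm A m n false x i ↔ 0 ≤ x ∧ x < A ∧ 0 ≤ i ∧ i < m := Iff.rfl

lemma Dm_true {A : ℝ} {m n : ℤ} {x : ℝ} {i : ℤ} :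
    Dm A m n true x i ↔ A ≤ x ∧ x < 1 ∧ 0 ≤ i ∧ i < n := Iff.rfl

/-- the relation: translate by `(v1, v2)` modulo the lattice -/
def Rel (A B c : ℝ) (m n : ℤ) (b : Bool → ℤ → ℝ) (v1 : ℝ) (v2 : ℤ) (y y' : ℝ) : Prop :=
  ∃ (col : Bool) (x : ℝ) (i : ℤ) (col' : Bool) (x' : ℝ) (i' : ℤ) (u w : ℤ),
    Dm A m n col x i ∧ Dm A m n col' x' i' ∧ y = b col i + c * x ∧ y' = b col' i' + c * x' ∧
    x' = x + v1 + u * B - w * A ∧ i' = i + v2 - u * m - w * n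

variable {A B c : ℝ} {m n : ℤ} {b : Bool → ℤ → ℝ}

lemma uniq_same {A B : ℝ} {m n : ℤ} (hA : 0 < A) (hB : 0 < B) (hm : 0 < m) (hn : 0 < n)
    {u w : ℤ} (h1 : u * B - w * A < A) (h2 : -A < u * B - w * A)
    (h3 : u * m + w * n < m) (h4 : -m < u * m + w * n) : u = 0 ∧ w = 0 := by
  have key : ∀ u w : ℤ, u * B - w * A < A → u * m + w * n < m → ¬ (0 < u) := by
    intro u w h1 h3 hu
    have hu' : (1:ℝ) ≤ u := by exact_mod_cast hu
    rcases lt_or_ge w 0 with hw | hw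
    · have hw' : (w:ℝ) ≤ -1 := by exact_mod_cast (by omega : w ≤ -1)
      nlinarith
    · nlinarith
  have k1 := key u w h1 h3
  have k2 := key (-u) (-w) (by push_cast; linarith) (by linarith)
  have hu : u = 0 := by omega
  subst hu
  refine ⟨rfl, ?_⟩
  simp only [Int.cast_zero, zero_mul, zero_sub] at h1 h2
  have a1 : (w:ℝ) < 1 := by nlinarith
  have a2 : (-1:ℝ) < w := by nlinarith
  have a1' : w < 1 := by exact_mod_cast a1
  have a2' : -1 < w := by exact_mod_cast a2
  omega

lemma uniq_diff {A B : ℝ} {m n : ℤ} (hA : 0 < A) (hB : 0 < B) (hm : 0 < m) (hn : 0 < n)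
    {u w : ℤ} (h1 : 0 < u * B - w * A) (h2 : u * B - w * A < A + B)
    (h3 : u * m + w * n < m) (h4 : -n < u * m + w * n) : False := by
  rcases lt_or_ge 0 u with hu | hu
  · have hu' : (1:ℝ) ≤ u := by exact_mod_cast hu
    rcases lt_or_ge w 0 with hw | hw
    · have hw' : (w:ℝ) ≤ -1 := by exact_mod_cast (by omega : w ≤ -1)
      nlinarith
    · nlinarith
  · have hu' : (u:ℝ) ≤ 0 := by exact_mod_cast hu
    rcases lt_or_ge w 0 with hw | hw
    · nlinarith
    · have hw' : (0:ℝ) ≤ w := by exact_mod_cast hw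
      nlinarith

lemma Dm_uniq (hA : 0 < A) (hB : 0 < B) (hAB : A + B = 1) (hm : 0 < m) (hn : 0 < n)
    {col col' : Bool} {x x' : ℝ} {i i' u w : ℤ} (h : Dm A m n col x i) (h' : Dm A m n col' x' i')
    (hx : x' = x + u * B - w * A) (hi : i' = i - u * m - w * n) :
    col = col' ∧ u = 0 ∧ w = 0 := by
  cases col <;> cases col' <;> simp only [Dm_false, Dm_true] at h h' <;>
    obtain ⟨a1, a2, a3, a4⟩ := h <;> obtain ⟨b1, b2, b3, b4⟩ := h'
  · exact ⟨rfl, uniq_same hA hB hm hn (by linarith) (by linarith) (by linarith) (by linarith)⟩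
  · exact (uniq_diff (u := u) (w := w) hA hB hm hn (by linarith) (by linarith) (by linarith)
      (by linarith)).elim
  · exact (uniq_diff (u := -u) (w := -w) hA hB hm hn (by push_cast; linarith)
      (by push_cast; linarith) (by linarith) (by linarith)).elim
  · have := uniq_same (u := -w) (w := -u) hB hA hn hm (by push_cast; linarith)
      (by push_cast; linarith) (by linarith) (by linarith)
    exact ⟨rfl, by omega, by omega⟩

lemma Dm_exists_nonneg (hA : 0 < A) (hB : 0 < B) (hAB : A + B = 1) (hm : 0 < m) (hn : 0 < n)
    (N : ℕ) : ∀ (x : ℝ) (i : ℤ), 0 ≤ x → x < 1 → 0 ≤ i → i < N →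
    ∃ (col : Bool) (u w : ℤ), Dm A m n col (x + u * B - w * A) (i - u * m - w * n) := by
  induction N with
  | zero => intro x i _ _ h1 h2; simp at h2; omega
  | succ N ih =>
    intro x i h0 h1 h2 h3
    push_cast at h3
    by_cases hx : x < A
    · by_cases hi : i < m
      · exact ⟨false, 0, 0, Dm_false.2 (by simp; exact ⟨h0, hx, h2, hi⟩)⟩
      · obtain ⟨col, u, w, h⟩ := ih (x + B) (i - m) (by linarith) (by linarith) (by omega) (by omega)
        refine ⟨col, u + 1, w, ?_⟩
        convert h using 1
        · push_cast; ring
        · ring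
    · by_cases hi : i < n
      · exact ⟨true, 0, 0, Dm_true.2 (by simp; exact ⟨not_lt.1 hx, h1, h2, hi⟩)⟩
      · obtain ⟨col, u, w, h⟩ := ih (x - A) (i - n) (by linarith) (by linarith) (by omega) (by omega)
        refine ⟨col, u, w + 1, ?_⟩
        convert h using 1
        · push_cast; ring
        · ring

lemma Dm_exists_unit (hA : 0 < A) (hB : 0 < B) (hAB : A + B = 1) (hm : 0 < m) (hn : 0 < n)
    (N : ℕ) : ∀ (x : ℝ) (i : ℤ), 0 ≤ x → x < 1 → -(N : ℤ) ≤ i →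
    ∃ (col : Bool) (u w : ℤ), Dm A m n col (x + u * B - w * A) (i - u * m - w * n) := by
  induction N with
  | zero =>
    intro x i h0 h1 h2
    exact Dm_exists_nonneg hA hB hAB hm hn (i.toNat + 1) x i h0 h1 (by simpa using h2)
      (by push_cast; omega)
  | succ N ih =>
    intro x i h0 h1 h2
    push_cast at h2
    by_cases hx : x < B
    · obtain ⟨col, u, w, h⟩ := ih (x + A) (i + n) (by linarith) (by linarith) (by omega)
      refine ⟨col, u, w - 1, ?_⟩
      convert h using 1
      · push_cast; ring
      · ring
    · obtain ⟨col, u, w, h⟩ := ih (x - B) (i + m) (by linarith) (by linarith) (by omega)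
      refine ⟨col, u - 1, w, ?_⟩
      convert h using 1
      · push_cast; ring
      · ring

lemma Dm_exists (hA : 0 < A) (hB : 0 < B) (hAB : A + B = 1) (hm : 0 < m) (hn : 0 < n)
    (x : ℝ) (i : ℤ) :
    ∃ (col : Bool) (u w : ℤ), Dm A m n col (x + u * B - w * A) (i - u * m - w * n) := by
  obtain ⟨col, u, w, h⟩ := Dm_exists_unit hA hB hAB hm hn
    (i + ⌊x⌋ * m - ⌊x⌋ * n).natAbs (Int.fract x) (i + ⌊x⌋ * m - ⌊x⌋ * n)
    (Int.fract_nonneg x) (Int.fract_lt_one x) (by omega)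
  refine ⟨col, u - ⌊x⌋, w + ⌊x⌋, ?_⟩
  convert h using 1
  · push_cast
    have := Int.self_sub_floor x
    have hf : (⌊x⌋:ℝ) * (A + B) = ⌊x⌋ := by rw [hAB, mul_one]
    linarith
  · ring

/-- the coding hypotheses -/
structure Coding (A B c : ℝ) (m n : ℤ) (b : Bool → ℤ → ℝ) : Prop where
  hA : 0 < A
  hB : 0 < B
  hAB : A + B = 1
  hm : 0 < m
  hn : 0 < n
  hc : 0 < c
  mem : ∀ col x i, Dm A m n col x i → b col i + c * x ∈ unitI
  surj : ∀ y ∈ unitI, ∃ col x i, Dm A m n col x i ∧ y = b col i + c * x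
  inj : ∀ col x i col' x' i', Dm A m n col x i → Dm A m n col' x' i' →
    b col i + c * x = b col' i' + c * x' → col = col' ∧ i = i'

lemma Rel.symm {v1 : ℝ} {v2 : ℤ} {y y' : ℝ} (h : Rel A B c m n b v1 v2 y y') :
    Rel A B c m n b (-v1) (-v2) y' y := by
  obtain ⟨col, x, i, col', x', i', u, w, h1, h2, h3, h4, h5, h6⟩ := h
  exact ⟨col', x', i', col, x, i, -u, -w, h2, h1, h4, h3, by push_cast; linarith, by linarith⟩

lemma Rel.trans (H : Coding A B c m n b) {v1 v1' : ℝ} {v2 v2' : ℤ} {y y' y'' : ℝ}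
    (h : Rel A B c m n b v1 v2 y y') (h' : Rel A B c m n b v1' v2' y' y'') :
    Rel A B c m n b (v1 + v1') (v2 + v2') y y'' := by
  obtain ⟨col, x, i, col', x', i', u, w, h1, h2, h3, h4, h5, h6⟩ := h
  obtain ⟨k1, z, j, k2, z', j', u', w', g1, g2, g3, g4, g5, g6⟩ := h'
  obtain ⟨e1, e2⟩ := H.inj _ _ _ _ _ _ h2 g1 (h4.symm.trans g3)
  subst e1 e2
  have e3 : x' = z := by
    have : c * x' = c * z := by linarith
    exact mul_left_cancel₀ H.hc.ne' this
  subst e3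
  exact ⟨col, x, i, k2, z', j', u + u', w + w', h1, g2, h3, g4, by push_cast; linarith, by linarith⟩

lemma Rel.lattice {v1 v1' : ℝ} {v2 v2' : ℤ} {y y' : ℝ} (u0 w0 : ℤ)
    (h : Rel A B c m n b v1 v2 y y') (e1 : v1' = v1 + u0 * B - w0 * A)
    (e2 : v2' = v2 - u0 * m - w0 * n) : Rel A B c m n b v1' v2' y y' := by
  obtain ⟨col, x, i, col', x', i', u, w, h1, h2, h3, h4, h5, h6⟩ := h
  exact ⟨col, x, i, col', x', i', u - u0, w - w0, h1, h2, h3, h4, by push_cast; linarith,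
    by linarith⟩

lemma Rel.zero (H : Coding A B c m n b) {y y' : ℝ} (h : Rel A B c m n b 0 0 y y') : y = y' := by
  obtain ⟨col, x, i, col', x', i', u, w, h1, h2, h3, h4, h5, h6⟩ := h
  obtain ⟨e1, e2, e3⟩ := Dm_uniq H.hA H.hB H.hAB H.hm H.hn (u := u) (w := w) h1 h2
    (by linarith) (by linarith)
  subst e1 e2 e3
  simp at h5 h6
  rw [h3, h4, h5, h6]

lemma Rel.unique (H : Coding A B c m n b) {v1 : ℝ} {v2 : ℤ} {y y' y'' : ℝ}
    (h : Rel A B c m n b v1 v2 y y') (h' : Rel A B c m n b v1 v2 y y'') : y' = y'' := by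
  have := h.symm.trans H h'
  simp only [neg_add_cancel] at this
  exact this.zero H

lemma Rel.mem_left (H : Coding A B c m n b) {v1 : ℝ} {v2 : ℤ} {y y' : ℝ}
    (h : Rel A B c m n b v1 v2 y y') : y ∈ unitI := by
  obtain ⟨col, x, i, col', x', i', u, w, h1, h2, h3, h4, h5, h6⟩ := h
  rw [h3]; exact H.mem _ _ _ h1

lemma Rel.mem_right (H : Coding A B c m n b) {v1 : ℝ} {v2 : ℤ} {y y' : ℝ}
    (h : Rel A B c m n b v1 v2 y y') : y' ∈ unitI := h.symm.mem_left H

lemma Rel.exists (H : Coding A B c m n b) (v1 : ℝ) (v2 : ℤ) {y : ℝ} (hy : y ∈ unitI) :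
    ∃ y', Rel A B c m n b v1 v2 y y' := by
  obtain ⟨col, x, i, h, e⟩ := H.surj y hy
  obtain ⟨col', u, w, h'⟩ := Dm_exists H.hA H.hB H.hAB H.hm H.hn (x + v1) (i + v2)
  exact ⟨_, col, x, i, col', _, _, u, w, h, h', e, rfl, rfl, rfl⟩

/-- criterion for being piecewise a translation -/
lemma piecewise_of_cover {ι : Type*} (F : Finset ι) (l r d : ι → ℝ) (S : ℝ → ℝ)
    (hcov : ∀ y ∈ unitI, ∃ i ∈ F, y ∈ Set.Ico (l i) (r i))
    (htr : ∀ i ∈ F, ∀ y ∈ Set.Ico (l i) (r i), y ∈ unitI → S y = y + d i) :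
    ∃ (k : ℕ) (β : Fin (k + 1) → ℝ), StrictMono β ∧ β 0 = 0 ∧ β (Fin.last k) = 1 ∧
    ∀ i : Fin k, ∃ c : ℝ, ∀ x ∈ Set.Ico (β i.castSucc) (β i.succ), S x = x + c := by
  classical
  let P : Finset ℝ := (insert 0 (insert 1 (F.image r))).filter (fun z => 0 ≤ z ∧ z ≤ 1)
  have h0 : (0:ℝ) ∈ P := by simp [P]
  have h1 : (1:ℝ) ∈ P := by simp [P]
  have hP : ∀ z ∈ P, 0 ≤ z ∧ z ≤ 1 := fun z hz => (Finset.mem_filter.1 hz).2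
  obtain ⟨k, hk⟩ : ∃ k, P.card = k + 1 :=
    ⟨P.card - 1, by have := Finset.card_pos.2 ⟨0, h0⟩; omega⟩
  let β := P.orderEmbOfFin hk
  have hβ : ∀ i, β i ∈ P := fun i => P.orderEmbOfFin_mem hk i
  have hrange : ∀ z ∈ P, ∃ i, β i = z := by
    intro z hz
    have : z ∈ Set.range β := by rw [Finset.range_orderEmbOfFin]; exact hz
    exact this
  have hmono : StrictMono β := β.strictMono
  have hb0 : β 0 = 0 := by
    obtain ⟨i, hi⟩ := hrange 0 h0
    have := hmono.monotone (Fin.zero_le i)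
    exact le_antisymm (hi ▸ this) (hP _ (hβ 0)).1
  have hb1 : β (Fin.last k) = 1 := by
    obtain ⟨i, hi⟩ := hrange 1 h1
    have := hmono.monotone (Fin.le_last i)
    exact le_antisymm (hP _ (hβ _)).2 (hi ▸ this)
  refine ⟨k, β, hmono, hb0, hb1, fun i => ?_⟩
  have hlt : β i.castSucc < β i.succ := hmono i.castSucc_lt_succ
  have hmem : β i.castSucc ∈ unitI := ⟨(hP _ (hβ _)).1, hlt.trans_le (hP _ (hβ _)).2⟩
  obtain ⟨j, hj, hj1, hj2⟩ := hcov _ hmem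
  refine ⟨d j, fun x hx => htr j hj x ⟨hj1.trans hx.1, ?_⟩
    ⟨hmem.1.trans hx.1, hx.2.trans_le (hP _ (hβ _)).2⟩⟩
  by_contra hcon
  push Not at hcon
  have hr : r j ∈ P := by
    simp only [P, Finset.mem_filter, Finset.mem_insert, Finset.mem_image]
    exact ⟨Or.inr (Or.inr ⟨j, hj, rfl⟩), hmem.1.trans hj2.le,
      hcon.trans (hx.2.le.trans (hP _ (hβ _)).2)⟩
  obtain ⟨q, hq⟩ := hrange _ hr
  rw [← hq] at hj2 hcon
  have q1 := hmono.lt_iff_lt.1 hj2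
  have q2 := hmono.lt_iff_lt.1 (hcon.trans_lt hx.2)
  rw [Fin.lt_def] at q1 q2
  simp at q1 q2
  omega

lemma bound_aux (H : Coding A B c m n b) (v1 : ℝ) (v2 : ℤ) : ∃ N : ℤ,
    ∀ (col : Bool) (x : ℝ) (i : ℤ) (col' : Bool) (x' : ℝ) (i' : ℤ) (u w : ℤ),
    Dm A m n col x i → Dm A m n col' x' i' →
    x' = x + v1 + u * B - w * A → i' = i + v2 - u * m - w * n →
    (-N ≤ u ∧ u ≤ N) ∧ (-N ≤ w ∧ w ≤ N) ∧ (0 ≤ i ∧ i ≤ m + n) := by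
  obtain ⟨hA, hB, hAB, hm, hn, -, -, -, -⟩ := H
  have hmR : (0:ℝ) < m := by exact_mod_cast hm
  have hnR : (0:ℝ) < n := by exact_mod_cast hn
  let X : ℝ := 1 + |v1|
  let Y : ℝ := m + n + |(v2:ℝ)|
  let Q : ℝ := n * B + m * A
  have hQ : 0 < Q := by positivity
  let N : ℤ := ⌈((n + m) * X + Y) / Q⌉
  have hN : (n + m) * X + Y ≤ Q * N := by
    have := Int.le_ceil (((n + m) * X + Y) / Q)
    rw [div_le_iff₀ hQ] at this
    linarith
  refine ⟨N, ?_⟩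
  intro col x i col' x' i' u w h h' hx hi
  have g : (0 ≤ x ∧ x < 1) ∧ 0 ≤ i ∧ i ≤ m + n := by
    cases col <;> simp only [Dm_false, Dm_true] at h <;> obtain ⟨a1, a2, a3, a4⟩ := h
    · exact ⟨⟨a1, by linarith⟩, a3, by omega⟩
    · exact ⟨⟨by linarith, a2⟩, a3, by omega⟩
  have g' : (0 ≤ x' ∧ x' < 1) ∧ 0 ≤ i' ∧ i' ≤ m + n := by
    cases col' <;> simp only [Dm_false, Dm_true] at h' <;> obtain ⟨a1, a2, a3, a4⟩ := h'
    · exact ⟨⟨a1, by linarith⟩, a3, by omega⟩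
    · exact ⟨⟨by linarith, a2⟩, a3, by omega⟩
  obtain ⟨⟨x1, x2⟩, i1, i2⟩ := g
  obtain ⟨⟨x1', x2'⟩, i1', i2'⟩ := g'
  have hi' : (i':ℝ) = i + v2 - u * m - w * n := by rw [hi]; push_cast; ring
  have i1R : (0:ℝ) ≤ i := by exact_mod_cast i1
  have i2R : (i:ℝ) ≤ m + n := by exact_mod_cast i2
  have i1R' : (0:ℝ) ≤ i' := by exact_mod_cast i1'
  have i2R' : (i':ℝ) ≤ m + n := by exact_mod_cast i2'
  have p1 : |u * B - w * A| ≤ X := by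
    have := neg_abs_le v1; have := le_abs_self v1
    rw [abs_le]; constructor <;> simp only [X] <;> linarith
  have p2 : |(u:ℝ) * m + w * n| ≤ Y := by
    have := neg_abs_le (v2:ℝ); have := le_abs_self (v2:ℝ)
    rw [abs_le]; constructor <;> simp only [Y] <;> linarith
  have hX : 0 ≤ X := by positivity
  have hY : 0 ≤ Y := by positivity
  rw [abs_le] at p1 p2
  have A1 : A ≤ 1 := by linarith
  have B1 : B ≤ 1 := by linarith
  have AY : A * Y ≤ Y := by nlinarith
  have BY : B * Y ≤ Y := by nlinarith
  have nX : 0 ≤ n * X := by positivity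
  have mX : 0 ≤ m * X := by positivity
  have eu : n * (u * B - w * A) + A * (u * m + w * n) = Q * u := by simp only [Q]; ring
  have ew : -(m * (u * B - w * A)) + B * (u * m + w * n) = Q * w := by simp only [Q]; ring
  have b1 := mul_le_mul_of_nonneg_left p1.1 hnR.le
  have b2 := mul_le_mul_of_nonneg_left p1.2 hnR.le
  have b3 := mul_le_mul_of_nonneg_left p1.1 hmR.le
  have b4 := mul_le_mul_of_nonneg_left p1.2 hmR.le
  have b5 := mul_le_mul_of_nonneg_left p2.1 hA.le
  have b6 := mul_le_mul_of_nonneg_left p2.2 hA.le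
  have b7 := mul_le_mul_of_nonneg_left p2.1 hB.le
  have b8 := mul_le_mul_of_nonneg_left p2.2 hB.le
  have c1 : Q * u ≤ Q * N := by linarith
  have c2 : Q * (-N) ≤ Q * u := by linarith
  have c3 : Q * w ≤ Q * N := by linarith
  have c4 : Q * (-N) ≤ Q * w := by linarith
  have d1 := le_of_mul_le_mul_left c1 hQ
  have d2 := le_of_mul_le_mul_left c2 hQ
  have d3 := le_of_mul_le_mul_left c3 hQ
  have d4 := le_of_mul_le_mul_left c4 hQ
  exact ⟨⟨by exact_mod_cast d2, by exact_mod_cast d1⟩,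
    ⟨by exact_mod_cast d4, by exact_mod_cast d3⟩, i1, i2⟩

lemma piecewise_of_rel (H : Coding A B c m n b) (v1 : ℝ) (v2 : ℤ) (S : ℝ → ℝ)
    (hS : ∀ y ∈ unitI, Rel A B c m n b v1 v2 y (S y)) :
    ∃ (k : ℕ) (β : Fin (k + 1) → ℝ), StrictMono β ∧ β 0 = 0 ∧ β (Fin.last k) = 1 ∧
    ∀ i : Fin k, ∃ c : ℝ, ∀ x ∈ Set.Ico (β i.castSucc) (β i.succ), S x = x + c := by
  classical
  obtain ⟨N, hN⟩ := bound_aux H v1 v2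
  have hc := H.hc
  let F : Finset (Bool × Bool × ℤ × ℤ × ℤ) :=
    ((Finset.univ : Finset Bool) ×ˢ (Finset.univ : Finset Bool) ×ˢ Finset.Icc 0 (m + n) ×ˢ
      Finset.Icc (-N) N ×ˢ Finset.Icc (-N) N).filter
    (fun q => 0 ≤ q.2.2.1 ∧ q.2.2.1 < (bif q.1 then n else m) ∧
      0 ≤ q.2.2.1 + v2 - q.2.2.2.1 * m - q.2.2.2.2 * n ∧
      q.2.2.1 + v2 - q.2.2.2.1 * m - q.2.2.2.2 * n < (bif q.2.1 then n else m))
  let sh : Bool × Bool × ℤ × ℤ × ℤ → ℝ := fun q => v1 + q.2.2.2.1 * B - q.2.2.2.2 * A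
  apply piecewise_of_cover F
    (fun q => max (b q.1 q.2.2.1 + c * (bif q.1 then A else 0))
      (b q.1 q.2.2.1 + c * ((bif q.2.1 then A else 0) - sh q)))
    (fun q => min (b q.1 q.2.2.1 + c * (bif q.1 then 1 else A))
      (b q.1 q.2.2.1 + c * ((bif q.2.1 then 1 else A) - sh q)))
    (fun q => b q.2.1 (q.2.2.1 + v2 - q.2.2.2.1 * m - q.2.2.2.2 * n) - b q.1 q.2.2.1 + c * sh q)
  · intro y hy
    obtain ⟨col, x, i, col', x', i', u, w, h1, h2, h3, h4, h5, h6⟩ := hS y hy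
    obtain ⟨⟨k1, k2⟩, ⟨k3, k4⟩, k5, k6⟩ := hN _ _ _ _ _ _ _ _ h1 h2 h5 h6
    refine ⟨(col, col', i, u, w), ?_, ?_⟩
    · simp only [F, Finset.mem_filter, Finset.mem_product, Finset.mem_univ, Finset.mem_Icc,
        true_and]
      exact ⟨⟨⟨k5, k6⟩, ⟨k1, k2⟩, k3, k4⟩, h1.2.2.1, h1.2.2.2, h6 ▸ h2.2.2.1, h6 ▸ h2.2.2.2⟩
    · simp only [sh, Set.mem_Ico, max_le_iff, lt_min_iff, h3, add_le_add_iff_left,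
        add_lt_add_iff_left, mul_le_mul_iff_right₀ hc, mul_lt_mul_iff_right₀ hc]
      have q1 := h2.1
      have q2 := h2.2.1
      exact ⟨⟨h1.1, by linarith⟩, h1.2.1, by linarith⟩
  · rintro ⟨col, col', i, u, w⟩ hq y hy hyu
    simp only [F, Finset.mem_filter, Finset.mem_product, Finset.mem_univ, Finset.mem_Icc,
        true_and] at hq
    obtain ⟨-, k1, k2, k3, k4⟩ := hq
    obtain ⟨x, hx⟩ : ∃ x, y = b col i + c * x := ⟨(y - b col i) / c, by field_simp; ring⟩
    simp only [sh, Set.mem_Ico, max_le_iff, lt_min_iff, hx, add_le_add_iff_left,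
        add_lt_add_iff_left, mul_le_mul_iff_right₀ hc, mul_lt_mul_iff_right₀ hc] at hy
    obtain ⟨⟨y1, y2⟩, y3, y4⟩ := hy
    have : Rel A B c m n b v1 v2 y (b col' (i + v2 - u * m - w * n) +
        c * (x + v1 + u * B - w * A)) :=
      ⟨col, x, i, col', _, _, u, w, ⟨y1, y3, k1, k2⟩,
        ⟨by linarith, by linarith, k3, k4⟩, hx, rfl, rfl, rfl⟩
    rw [(hS y hyu).unique H this, hx]
    simp only [sh]
    ring

theorem root_of_coding (H : Coding A B c m n b) (T : ℝ → ℝ) (hTo : ∀ x, x ∉ unitI → T x = x)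
    (hT : ∀ y ∈ unitI, Rel A B c m n b 0 1 y (T y)) : HasNontrivialRoot T := by
  classical
  have hm := H.hm
  let v : ℝ := -B / (m + 1)
  choose! f hf using fun (y : ℝ) (hy : y ∈ unitI) => Rel.exists H v 1 hy
  choose! g hg using fun (y : ℝ) (hy : y ∈ unitI) => Rel.exists H (-v) (-1) hy
  let S : ℝ → ℝ := fun y => if y ∈ unitI then f y else y
  have hS : ∀ y ∈ unitI, Rel A B c m n b v 1 y (S y) := by
    intro y hy; simp only [S, if_pos hy]; exact hf y hy
  have hSo : ∀ y, y ∉ unitI → S y = y := by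
    intro y hy; simp only [S, if_neg hy]
  refine ⟨S, m.toNat + 1, ⟨⟨?_, ?_, ?_⟩, hSo, piecewise_of_rel H v 1 S hS⟩, by omega, ?_⟩
  · intro y hy; exact (hS y hy).mem_right H
  · intro y hy z hz e
    have h1 := (hS y hy).symm
    have h2 := (hS z hz).symm
    rw [e] at h1
    exact h1.unique H h2
  · intro y hy
    have h1 := (hg y hy).symm
    simp only [neg_neg] at h1
    exact ⟨g y, h1.mem_left H, (hS _ (h1.mem_left H)).unique H h1⟩
  · funext y
    by_cases hy : y ∈ unitI
    · have hit : ∀ j : ℕ, Rel A B c m n b ((j + 1 : ℕ) * v) (j + 1 : ℕ) y (S^[j + 1] y) := by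
        intro j
        induction j with
        | zero => simpa using hS y hy
        | succ j ih =>
          rw [Function.iterate_succ_apply']
          have := ih.trans H (hS _ (ih.mem_right H))
          convert this using 1
          · push_cast; ring
          · push_cast; ring
      have h := hit m.toNat
      have hmc : ((m.toNat + 1 : ℕ) : ℤ) = m + 1 := by push_cast; omega
      have hmcR : ((m.toNat + 1 : ℕ) : ℝ) = m + 1 := by exact_mod_cast congrArg (Int.cast (R := ℝ)) hmc
      have hm1 : (m:ℝ) + 1 ≠ 0 := by
        have : (0:ℝ) < m := by exact_mod_cast hm
        positivity
      have h' : Rel A B c m n b 0 1 y (S^[m.toNat + 1] y) := by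
        apply h.lattice 1 0
        · rw [hmcR]; simp only [v]; field_simp; push_cast; ring
        · rw [hmc]; ring
      exact h'.unique H (hT y hy)
    · rw [hTo y hy, Function.iterate_fixed (hSo y hy)]

end RootProof

theorem stmt6 (T S : ℝ → ℝ) (m n : ℕ)
    (hS : IsRotation S) (hSmin : IsMinimal S)
    (hT : IsTowerOver T ![m, n] S) :
    HasNontrivialRoot T := by
  obtain ⟨hTI, -, hpos, t, c, a, htm, ht0, ht2, hc, htr, hsub, hdisj, hcov, hup, htop⟩ := hT
  obtain ⟨-, α, ⟨hα0, hα1⟩, hrot⟩ := hS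
  have hm : 0 < m := by simpa using hpos 0
  have hn : 0 < n := by simpa using hpos 1
  simp only [Fin.forall_fin_two, Fin.exists_fin_two] at htr hsub hdisj hcov hup htop
  have e0 : (Fin.castSucc (0 : Fin 2)) = (0 : Fin 3) := rfl
  have e1 : (Fin.castSucc (1 : Fin 2)) = (1 : Fin 3) := rfl
  have e2 : (Fin.succ (0 : Fin 2)) = (1 : Fin 3) := rfl
  have e3 : (Fin.succ (1 : Fin 2)) = (2 : Fin 3) := rfl
  have ht2' : t 2 = 1 := ht2
  have hA : 0 < t 1 := by rw [← ht0]; exact htm (by decide)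
  have hA1 : t 1 < 1 := by rw [← ht2']; exact htm (by decide)
  generalize hAdef : t 1 = A at *
  simp only [e0, e1, e2, e3, ht0, ht2', hAdef, Matrix.cons_val_zero, Matrix.cons_val_one,
    sub_zero] at htr hsub hdisj hcov hup htop
  have hval : ∀ x, 0 ≤ x → x < 1 - α → S x = x + α := by
    intro x h0 h1
    rw [hrot x ⟨h0, by linarith⟩, Int.fract_eq_self.2 ⟨by linarith, by linarith⟩]
  have hval' : ∀ x, 1 - α ≤ x → x < 1 → S x = x + α - 1 := by
    intro x h0 h1
    rw [hrot x ⟨by linarith, h1⟩, Int.fract_eq_iff]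
    exact ⟨by linarith, by linarith, 1, by push_cast; ring⟩
  have hAα : A = 1 - α := by
    obtain ⟨⟨d, hd⟩, d', hd'⟩ := htr
    rcases lt_trichotomy A (1 - α) with h | h | h
    · have q1 := hd' A ⟨le_rfl, hA1⟩
      have q2 := hd' (1 - α) ⟨h.le, by linarith⟩
      rw [hval A hA.le h] at q1
      rw [hval' _ le_rfl (by linarith)] at q2
      linarith
    · exact h
    · have q1 := hd 0 ⟨le_rfl, hA⟩
      have q2 := hd (1 - α) ⟨by linarith, h⟩
      rw [hval 0 le_rfl (by linarith)] at q1
      rw [hval' _ le_rfl (by linarith)] at q2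
      linarith
  have hS0 : ∀ x, 0 ≤ x → x < A → S x = x + (1 - A) := by
    intro x h0 h1; rw [hval x h0 (by linarith)]; linarith
  have hS1 : ∀ x, A ≤ x → x < 1 → S x = x - A := by
    intro x h0 h1; rw [hval' x (by linarith) h1]; linarith
  let b : Bool → ℤ → ℝ := fun col i => bif col then a 1 i.toNat - c * A else a 0 i.toNat
  have hb0 : ∀ i, b false i = a 0 i.toNat := fun i => rfl
  have hb1 : ∀ i, b true i = a 1 i.toNat - c * A := fun i => rfl
  have hin0 : ∀ x i, Dm A m n false x i → i.toNat < m ∧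
      b false i + c * x ∈ Set.Ico (a 0 i.toNat) (a 0 i.toNat + c * A) := by
    intro x i h
    obtain ⟨h1, h2, h3, h4⟩ := Dm_false.1 h
    refine ⟨by omega, ?_, ?_⟩
    · rw [hb0]; nlinarith
    · rw [hb0]; nlinarith
  have hin1 : ∀ x i, Dm A m n true x i → i.toNat < n ∧
      b true i + c * x ∈ Set.Ico (a 1 i.toNat) (a 1 i.toNat + c * (1 - A)) := by
    intro x i h
    obtain ⟨h1, h2, h3, h4⟩ := Dm_true.1 h
    refine ⟨by omega, ?_, ?_⟩
    · rw [hb1]; nlinarith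
    · rw [hb1]; nlinarith
  obtain ⟨⟨hd00, hd01⟩, hd10, hd11⟩ := hdisj
  have H : Coding A (1 - A) c m n b := by
    refine ⟨hA, by linarith, by ring, by exact_mod_cast hm, by exact_mod_cast hn, hc, ?_, ?_, ?_⟩
    · intro col x i h
      cases col
      · exact hsub.1 _ (hin0 x i h).1 (hin0 x i h).2
      · exact hsub.2 _ (hin1 x i h).1 (hin1 x i h).2
    · intro y hy
      rcases hcov y hy with ⟨j, hj, h1, h2⟩ | ⟨j, hj, h1, h2⟩
      · refine ⟨false, (y - a 0 j) / c, j, Dm_false.2 ⟨div_nonneg (by linarith) hc.le, ?_,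
          by omega, by omega⟩, ?_⟩
        · rw [div_lt_iff₀ hc]; linarith
        · rw [hb0]; simp; field_simp; ring
      · refine ⟨true, (y - a 1 j) / c + A, j, Dm_true.2 ⟨?_, ?_, by omega, by omega⟩, ?_⟩
        · have : 0 ≤ (y - a 1 j) / c := div_nonneg (by linarith) hc.le
          linarith
        · have : (y - a 1 j) / c < 1 - A := by rw [div_lt_iff₀ hc]; linarith
          linarith
        · rw [hb1]; simp; field_simp; ring
    · intro col x i col' x' i' h h' e
      have i0 : 0 ≤ i := h.2.2.1
      have i0' : 0 ≤ i' := h'.2.2.1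
      cases col <;> cases col'
      · obtain ⟨p1, p2⟩ := hin0 _ _ h
        obtain ⟨q1, q2⟩ := hin0 _ _ h'
        refine ⟨rfl, ?_⟩
        by_contra hne
        refine Set.disjoint_left.1 (hd00 _ _ p1 q1 ?_) p2 (e ▸ q2)
        intro hh; simp at hh; omega
      · obtain ⟨p1, p2⟩ := hin0 _ _ h
        obtain ⟨q1, q2⟩ := hin1 _ _ h'
        exact (Set.disjoint_left.1 (hd01 _ _ p1 q1 (by simp)) p2 (e ▸ q2)).elim
      · obtain ⟨p1, p2⟩ := hin1 _ _ h
        obtain ⟨q1, q2⟩ := hin0 _ _ h'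
        exact (Set.disjoint_left.1 (hd10 _ _ p1 q1 (by simp)) p2 (e ▸ q2)).elim
      · obtain ⟨p1, p2⟩ := hin1 _ _ h
        obtain ⟨q1, q2⟩ := hin1 _ _ h'
        refine ⟨rfl, ?_⟩
        by_contra hne
        refine Set.disjoint_left.1 (hd11 _ _ p1 q1 ?_) p2 (e ▸ q2)
        intro hh; simp at hh; omega
  have hbase : ∀ z, 0 ≤ z → z < 1 → ∃ col, Dm A m n col z 0 ∧
      ((col = false ∧ z < A) ∨ (col = true ∧ A ≤ z)) := by
    intro z h0 h1
    by_cases hz : z < A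
    · exact ⟨false, Dm_false.2 ⟨h0, hz, le_rfl, by exact_mod_cast hm⟩, Or.inl ⟨rfl, hz⟩⟩
    · exact ⟨true, Dm_true.2 ⟨not_lt.1 hz, h1, le_rfl, by exact_mod_cast hn⟩,
        Or.inr ⟨rfl, not_lt.1 hz⟩⟩
  apply root_of_coding H T hTI.2.1
  intro y hy
  obtain ⟨col, x, i, h, e⟩ := H.surj y hy
  have hh := h
  cases col
  · obtain ⟨h1, h2, h3, h4⟩ := Dm_false.1 h
    by_cases hi : i + 1 < m
    · refine ⟨false, x, i, false, x, i + 1, 0, 0, h, Dm_false.2 ⟨h1, h2, by omega, hi⟩, e, ?_,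
        by simp, by ring⟩
      have := hup.1 i.toNat (by omega) x ⟨h1, h2⟩
      rw [e, hb0, hb0, this]
      congr 2
      omega
    · have hx : S x = x + (1 - A) := hS0 x h1 h2
      obtain ⟨col', hD, hor⟩ := hbase (S x) (by linarith) (by linarith)
      refine ⟨false, x, i, col', S x, 0, 1, 0, h, hD, e, ?_, by rw [hx]; simp,
        by simp; omega⟩
      have him : i.toNat = m - 1 := by omega
      rcases hor with ⟨rfl, hz⟩ | ⟨rfl, hz⟩
      · have := (htop.1 x ⟨h1, h2⟩).1 ⟨by linarith, hz⟩
        rw [e, hb0, hb0, him, this]; simp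
      · have := (htop.1 x ⟨h1, h2⟩).2 ⟨hz, by linarith⟩
        rw [e, hb0, hb1, him, this]; simp; ring
  · obtain ⟨h1, h2, h3, h4⟩ := Dm_true.1 h
    have hy' : y = a 1 i.toNat + c * (x - A) := by rw [e, hb1]; ring
    by_cases hi : i + 1 < n
    · refine ⟨true, x, i, true, x, i + 1, 0, 0, h, Dm_true.2 ⟨h1, h2, by omega, hi⟩, e, ?_,
        by simp, by ring⟩
      have := hup.2 i.toNat (by omega) x ⟨h1, h2⟩
      have hn1 : (i + 1).toNat = i.toNat + 1 := by omega
      rw [hy', this, hb1, hn1]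
      ring
    · have hx : S x = x - A := hS1 x h1 h2
      obtain ⟨col', hD, hor⟩ := hbase (S x) (by linarith) (by linarith)
      refine ⟨true, x, i, col', S x, 0, 0, 1, h, hD, e, ?_, by rw [hx]; simp,
        by simp; omega⟩
      have him : i.toNat = n - 1 := by omega
      rcases hor with ⟨rfl, hz⟩ | ⟨rfl, hz⟩
      · have := (htop.2 x ⟨h1, h2⟩).1 ⟨by linarith, hz⟩
        rw [hy', hb0, him, this]; simp
      · have := (htop.2 x ⟨h1, h2⟩).2 ⟨hz, by linarith⟩
        rw [hy', hb1, him, this]; simp; ring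


end IETRoots
end

section
/- Let T be an interval exchange transformation with precisely m−1 points of discontinuity. Then there exist a separating permutation π ∈ S_m and a vector λ ∈ Δ_m, both of which are unique, such that T = T_{(π,λ)}. -/
open Set

namespace IETRoots

theorem aux_betaPt_zero {m : ℕ} (lam : Fin m → ℝ) : betaPt lam 0 = 0 := by
  simp [betaPt]

theorem aux_betaPt_succ {m : ℕ} (lam : Fin m → ℝ) (j : Fin m) :
    betaPt lam ((j : ℕ) + 1) = betaPt lam (j : ℕ) + lam j := by
  unfold betaPt
  have : (Finset.univ.filter (fun i : Fin m => (i : ℕ) < (j : ℕ) + 1)) =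
      insert j (Finset.univ.filter (fun i : Fin m => (i : ℕ) < (j : ℕ))) := by
    ext i
    simp only [Finset.mem_filter, Finset.mem_univ, true_and, Finset.mem_insert, Fin.ext_iff]
    omega
  rw [this, Finset.sum_insert (by simp)]
  ring

theorem aux_betaPt_last {m : ℕ} (lam : Fin m → ℝ) : betaPt lam m = ∑ i, lam i := by
  unfold betaPt
  congr 1
  ext i
  simp

theorem aux_betaPt_strictMono {m : ℕ} (lam : Fin m → ℝ) (hpos : ∀ i, 0 < lam i)
    {a b : ℕ} (hab : a < b) (hb : b ≤ m) : betaPt lam a < betaPt lam b := by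
  induction b with
  | zero => omega
  | succ b ih =>
    have h1 := aux_betaPt_succ lam ⟨b, hb⟩
    have h2 := hpos ⟨b, hb⟩
    simp only at h1
    rcases Nat.lt_succ_iff_lt_or_eq.mp hab with h | h
    · have := ih h (by omega)
      linarith
    · subst h
      linarith

theorem aux_locate (g : ℕ → ℝ) (k : ℕ) (x : ℝ) (h0 : g 0 ≤ x) (h1 : x < g k) :
    ∃ j < k, g j ≤ x ∧ x < g (j + 1) := by
  induction k with
  | zero => linarith
  | succ k ih =>
    by_cases h : x < g k
    · obtain ⟨j, hj, h⟩ := ih h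
      exact ⟨j, by omega, h⟩
    · exact ⟨k, by omega, not_lt.mp h, h1⟩

theorem aux_beta_locate {m : ℕ} (lam : Fin m → ℝ) (hsum : ∑ i, lam i = 1) {x : ℝ}
    (hx : x ∈ unitI) :
    ∃ j : Fin m, x ∈ Set.Ico (betaPt lam (j : ℕ)) (betaPt lam (j : ℕ) + lam j) := by
  obtain ⟨j, hj, h1, h2⟩ := aux_locate (betaPt lam) m x
    (by rw [aux_betaPt_zero]; exact hx.1) (by rw [aux_betaPt_last, hsum]; exact hx.2)
  exact ⟨⟨j, hj⟩, h1, by rw [← aux_betaPt_succ lam ⟨j, hj⟩]; exact h2⟩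

theorem aux_beta_unique {m : ℕ} (lam : Fin m → ℝ) (hpos : ∀ i, 0 < lam i) {x : ℝ} {i j : Fin m}
    (hi : x ∈ Set.Ico (betaPt lam (i : ℕ)) (betaPt lam (i : ℕ) + lam i))
    (hj : x ∈ Set.Ico (betaPt lam (j : ℕ)) (betaPt lam (j : ℕ) + lam j)) : i = j := by
  rw [← aux_betaPt_succ] at hi hj
  have key : ∀ a b : Fin m, x < betaPt lam ((a : ℕ) + 1) → betaPt lam (b : ℕ) ≤ x →
      ¬ ((a : ℕ) < b) := by
    intro a b h1 h2 h
    rcases Nat.lt_or_eq_of_le (Nat.succ_le_of_lt h) with h' | h'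
    · have := aux_betaPt_strictMono lam hpos h' b.2.le
      simp only [Nat.succ_eq_add_one] at this
      linarith
    · rw [← h'] at h2
      simp only [Nat.succ_eq_add_one] at h2
      linarith
  have h1 := key i j hi.2 hj.1
  have h2 := key j i hj.2 hi.1
  exact Fin.ext (by omega)

theorem aux_ietMap_eq {m : ℕ} (π : Equiv.Perm (Fin m)) (lam : Fin m → ℝ)
    (hpos : ∀ i, 0 < lam i) {x : ℝ} {j : Fin m}
    (hj : x ∈ Set.Ico (betaPt lam (j : ℕ)) (betaPt lam (j : ℕ) + lam j)) :
    ietMap π lam x = x - betaPt lam (j : ℕ) +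
      ∑ i ∈ Finset.univ.filter (fun i : Fin m => π i < π j), lam i := by
  have h : ∃ j : Fin m, x ∈ Set.Ico (betaPt lam (j : ℕ)) (betaPt lam (j : ℕ) + lam j) := ⟨j, hj⟩
  have hc : h.choose = j := aux_beta_unique lam hpos h.choose_spec hj
  unfold ietMap
  rw [dif_pos h, hc]

/-- An IET takes finitely many displacements and is locally a translation on the right. -/
theorem aux_iet {T : ℝ → ℝ} (hT : IsIET T) :
    (∃ C : Set ℝ, C.Finite ∧ ∀ x ∈ unitI, T x - x ∈ C) ∧
    ∀ x ∈ unitI, ContinuousWithinAt T (Set.Ici x) x := by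
  obtain ⟨-, -, k, β, hmono, h0, h1, hc⟩ := hT
  choose c hc using hc
  have loc : ∀ x ∈ unitI, ∃ i : Fin k, x ∈ Set.Ico (β i.castSucc) (β i.succ) := by
    intro x hx
    obtain ⟨j, hj, h2, h3⟩ := aux_locate
      (fun n => β ⟨min n k, by omega⟩) k x
      (by
        have : (⟨min 0 k, by omega⟩ : Fin (k + 1)) = 0 := by ext; simp
        simp only [this, h0]; exact hx.1)
      (by
        have : (⟨min k k, by omega⟩ : Fin (k + 1)) = Fin.last k := by ext; simp
        simp only [this, h1]; exact hx.2)
    refine ⟨⟨j, hj⟩, ?_, ?_⟩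
    · have e1 : (⟨min j k, by omega⟩ : Fin (k + 1)) = (⟨j, hj⟩ : Fin k).castSucc :=
        Fin.ext (min_eq_left hj.le)
      rw [← e1]
      exact h2
    · have e2 : (⟨min (j + 1) k, by omega⟩ : Fin (k + 1)) = (⟨j, hj⟩ : Fin k).succ :=
        Fin.ext (min_eq_left hj)
      rw [← e2]
      exact h3
  refine ⟨⟨Set.range c, Set.finite_range c, fun x hx => ?_⟩, fun x hx => ?_⟩
  · obtain ⟨i, hi⟩ := loc x hx
    exact ⟨i, by rw [hc i x hi]; ring⟩
  · obtain ⟨i, hi⟩ := loc x hx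
    have hcont : ContinuousWithinAt (fun y => y + c i) (Set.Ici x) x := by fun_prop
    refine hcont.congr_of_eventuallyEq ?_ (hc i x hi)
    have : Set.Ico x (β i.succ) ∈ nhdsWithin x (Set.Ici x) := Ico_mem_nhdsGE hi.2
    filter_upwards [this] with y hy
    exact hc i y ⟨hi.1.trans hy.1, hy.2⟩

theorem aux_translation {T : ℝ → ℝ} (hT : IsIET T) {a b : ℝ} (ha : 0 ≤ a) (hb : b ≤ 1)
    (hD : ∀ x ∈ Set.Ioo a b, x ∉ DiscSet T) :
    ∀ x ∈ Set.Ico a b, T x = T a + (x - a) := by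
  intro x hx
  obtain ⟨⟨C, hCf, hC⟩, hr⟩ := aux_iet hT
  have hsub : Set.Ico a b ⊆ unitI := fun y hy => ⟨ha.trans hy.1, hy.2.trans_le hb⟩
  have hcont : ContinuousOn (fun y => T y - y) (Set.Ico a b) := by
    refine ContinuousOn.sub ?_ continuousOn_id
    intro y hy
    rcases eq_or_lt_of_le hy.1 with h | h
    · subst h
      exact (hr _ (hsub hy)).mono (fun z hz => hz.1)
    · have := hD y ⟨h, hy.2⟩
      have h2 : ContinuousWithinAt T unitI y := by
        by_contra hn
        exact this ⟨hsub hy, hn⟩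
      exact h2.mono hsub
  have : Finite C := hCf
  have hdisc : DiscreteTopology C := inferInstance
  have := isPreconnected_Ico.constant_of_mapsTo ⟨hdisc⟩ hcont
    (fun y hy => hC y (hsub hy)) hx (⟨le_rfl, hx.1.trans_lt hx.2⟩ : a ∈ Set.Ico a b)
  linarith

theorem aux_disc_pos {T : ℝ → ℝ} (hT : IsIET T) : (0 : ℝ) ∉ DiscSet T := by
  intro h
  exact h.2 (((aux_iet hT).2 0 h.1).mono (fun z hz => hz.1))

theorem aux_perm {m : ℕ} (v : Fin m → ℝ) (hv : Function.Injective v) :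
    ∃ π : Equiv.Perm (Fin m), ∀ i j, π i < π j ↔ v i < v j := by
  have hs : StrictMono (v ∘ Tuple.sort v) :=
    (Tuple.monotone_sort v).strictMono_of_injective (hv.comp (Equiv.injective _))
  refine ⟨(Tuple.sort v).symm, fun i j => ?_⟩
  have := hs.lt_iff_lt (a := (Tuple.sort v).symm i) (b := (Tuple.sort v).symm j)
  simpa using this.symm

theorem aux_perm_unique {m : ℕ} (π ρ : Equiv.Perm (Fin m))
    (h : ∀ i j, π i < π j ↔ ρ i < ρ j) : π = ρ := by
  have hs : StrictMono (fun i => ρ (π.symm i)) := by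
    intro a b hab
    refine (h _ _).1 ?_
    simpa using hab
  have hid : (fun i => ρ (π.symm i)) = id := by
    have h1 : Set.range (fun i => ρ (π.symm i)) = Set.range (id : Fin m → Fin m) := by
      rw [Set.range_id]
      exact (ρ.surjective.comp π.symm.surjective).range_eq
    exact (hs.range_inj strictMono_id).1 h1
  ext i
  have := congrFun hid (π i)
  simp at this
  rw [this]

theorem aux_sum {m : ℕ} (T : ℝ → ℝ) (hT : IsIET T) (g lam : Fin m → ℝ) (hpos : ∀ i, 0 < lam i)
    (hsub : ∀ i, Set.Ico (g i) (g i + lam i) ⊆ unitI)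
    (hcov : ∀ x ∈ unitI, ∃ i, x ∈ Set.Ico (g i) (g i + lam i))
    (huniq : ∀ x i j, x ∈ Set.Ico (g i) (g i + lam i) → x ∈ Set.Ico (g j) (g j + lam j) → i = j)
    (htr : ∀ i, ∀ x ∈ Set.Ico (g i) (g i + lam i), T x = T (g i) + (x - g i)) (j : Fin m) :
    T (g j) = ∑ i ∈ Finset.univ.filter (fun i => T (g i) < T (g j)), lam i := by
  have hmem : ∀ i, g i ∈ Set.Ico (g i) (g i + lam i) := fun i => ⟨le_rfl, by linarith [hpos i]⟩
  have hbij := hT.1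
  have hpre : ∀ i y, y ∈ Set.Ico (T (g i)) (T (g i) + lam i) →
      ∃ x ∈ Set.Ico (g i) (g i + lam i), T x = y := by
    intro i y hy
    have hx : y - T (g i) + g i ∈ Set.Ico (g i) (g i + lam i) :=
      ⟨by linarith [hy.1], by linarith [hy.2]⟩
    exact ⟨_, hx, by rw [htr i _ hx]; ring⟩
  have hunion : Set.Ico 0 (T (g j)) =
      ⋃ i ∈ Finset.univ.filter (fun i => T (g i) < T (g j)),
        Set.Ico (T (g i)) (T (g i) + lam i) := by
    ext y
    simp only [Set.mem_iUnion, Finset.mem_filter, Finset.mem_univ, true_and, exists_prop]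
    constructor
    · intro hy
      have hTj := hbij.mapsTo (hsub j (hmem j))
      obtain ⟨x, hx, rfl⟩ := hbij.surjOn (⟨hy.1, hy.2.trans hTj.2⟩ : y ∈ unitI)
      obtain ⟨i, hi⟩ := hcov x hx
      have := htr i x hi
      refine ⟨i, ?_, ?_, ?_⟩
      · linarith [hy.2, hi.1]
      · linarith [hi.1]
      · linarith [hi.2]
    · rintro ⟨i, hij, hy⟩
      refine ⟨(hbij.mapsTo (hsub i (hmem i))).1.trans hy.1, ?_⟩
      by_contra hn
      obtain ⟨x, hx, hxe⟩ := hpre i (T (g j)) ⟨hij.le, (not_lt.1 hn).trans_lt hy.2⟩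
      have := hbij.injOn (hsub i hx) (hsub j (hmem j)) hxe
      rw [this] at hx
      have := huniq _ _ _ hx (hmem j)
      rw [this] at hij
      exact lt_irrefl _ hij
  have hvol := congrArg MeasureTheory.volume hunion
  rw [MeasureTheory.measure_biUnion_finset] at hvol
  · simp only [Real.volume_Ico, sub_zero, add_sub_cancel_left] at hvol
    rw [← ENNReal.ofReal_sum_of_nonneg (fun i _ => (hpos i).le)] at hvol
    exact (ENNReal.ofReal_eq_ofReal_iff (hbij.mapsTo (hsub j (hmem j))).1
      (Finset.sum_nonneg (fun i _ => (hpos i).le))).1 hvol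
  · intro a _ b _ hab
    rw [Function.onFun, Set.disjoint_left]
    intro y hya hyb
    obtain ⟨x, hx, hxe⟩ := hpre a y hya
    obtain ⟨x', hx', hxe'⟩ := hpre b y hyb
    have := hbij.injOn (hsub a hx) (hsub b hx') (hxe.trans hxe'.symm)
    rw [← this] at hx'
    exact hab (huniq _ _ _ hx hx')
  · intro i _
    exact measurableSet_Ico

theorem aux_sum_lt {m : ℕ} (π : Equiv.Perm (Fin m)) (lam : Fin m → ℝ) (hpos : ∀ i, 0 < lam i)
    {i j : Fin m} (hij : π i < π j) :
    ∑ k ∈ Finset.univ.filter (fun k => π k < π i), lam k <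
      ∑ k ∈ Finset.univ.filter (fun k => π k < π j), lam k := by
  refine Finset.sum_lt_sum_of_subset (i := i) ?_ ?_ ?_ (hpos i) (fun k _ _ => (hpos k).le)
  · intro k hk
    simp only [Finset.mem_filter, Finset.mem_univ, true_and] at hk ⊢
    exact hk.trans hij
  · simpa using hij
  · simp

theorem aux_sum_lt_iff {m : ℕ} (π : Equiv.Perm (Fin m)) (lam : Fin m → ℝ) (hpos : ∀ i, 0 < lam i)
    (i j : Fin m) : π i < π j ↔
    ∑ k ∈ Finset.univ.filter (fun k => π k < π i), lam k <
      ∑ k ∈ Finset.univ.filter (fun k => π k < π j), lam k := by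
  refine ⟨aux_sum_lt π lam hpos, fun h => ?_⟩
  by_contra hn
  rcases lt_or_eq_of_le (not_lt.1 hn) with h' | h'
  · exact lt_asymm h (aux_sum_lt π lam hpos h')
  · rw [h'] at h
    exact lt_irrefl _ h

/-- Any representation has its breakpoints at `0` and the discontinuities. -/
theorem aux_beta_eq {m : ℕ} {T : ℝ → ℝ} (S : Finset ℝ) (hS : S.card = m)
    (hSD : (S : Set ℝ) = insert 0 (DiscSet T)) (π : Equiv.Perm (Fin m)) (lam : Fin m → ℝ)
    (hm : 1 ≤ m) (hpos : ∀ i, 0 < lam i) (hsum : ∑ i, lam i = 1) (hTe : T = ietMap π lam)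
    (i : Fin m) : betaPt lam (i : ℕ) = S.orderEmbOfFin hS i := by
  have hmono : StrictMono (fun i : Fin m => betaPt lam (i : ℕ)) := fun a b hab =>
    aux_betaPt_strictMono lam hpos hab b.2.le
  have hsub : S ⊆ Finset.univ.image (fun i : Fin m => betaPt lam (i : ℕ)) := by
    intro x hx
    have hx' : x ∈ insert 0 (DiscSet T) := by rw [← hSD]; exact hx
    rw [Finset.mem_image]
    rcases hx' with h | h
    · exact ⟨⟨0, hm⟩, Finset.mem_univ _, by rw [h]; exact aux_betaPt_zero lam⟩
    · obtain ⟨j, hj⟩ := aux_beta_locate lam hsum h.1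
      refine ⟨j, Finset.mem_univ _, ?_⟩
      by_contra hne
      have hlt : betaPt lam (j : ℕ) < x := lt_of_le_of_ne hj.1 hne
      refine h.2 (ContinuousAt.continuousWithinAt ?_)
      have hc : ContinuousAt (fun y => y - betaPt lam (j : ℕ) +
        ∑ i ∈ Finset.univ.filter (fun i : Fin m => π i < π j), lam i) x := by fun_prop
      refine hc.congr ?_
      filter_upwards [Ioo_mem_nhds hlt hj.2] with y hy
      rw [hTe, aux_ietMap_eq π lam hpos (j := j) ⟨hy.1.le, hy.2⟩]
  have heq : S = Finset.univ.image (fun i : Fin m => betaPt lam (i : ℕ)) := by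
    refine Finset.eq_of_subset_of_card_le hsub ?_
    rw [hS]
    exact Finset.card_image_le.trans (by simp)
  have := Finset.orderEmbOfFin_unique hS (f := fun i : Fin m => betaPt lam (i : ℕ))
    (fun i => by rw [heq]; exact Finset.mem_image_of_mem _ (Finset.mem_univ i)) hmono
  exact congrFun this i

theorem aux_unique {m : ℕ} {T : ℝ → ℝ} (S : Finset ℝ) (hS : S.card = m)
    (hSD : (S : Set ℝ) = insert 0 (DiscSet T)) (hm : 1 ≤ m)
    (π ρ : Equiv.Perm (Fin m)) (lam mu : Fin m → ℝ)
    (hpos : ∀ i, 0 < lam i) (hsum : ∑ i, lam i = 1) (hTe : T = ietMap π lam)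
    (hpos' : ∀ i, 0 < mu i) (hsum' : ∑ i, mu i = 1) (hTe' : T = ietMap ρ mu) :
    π = ρ ∧ lam = mu := by
  have hb : ∀ n ≤ m, betaPt lam n = betaPt mu n := by
    intro n hn
    rcases lt_or_eq_of_le hn with h | h
    · have h1 := aux_beta_eq S hS hSD π lam hm hpos hsum hTe ⟨n, h⟩
      have h2 := aux_beta_eq S hS hSD ρ mu hm hpos' hsum' hTe' ⟨n, h⟩
      exact h1.trans h2.symm
    · rw [h, aux_betaPt_last, aux_betaPt_last, hsum, hsum']
  have hlam : lam = mu := by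
    funext i
    have h1 := aux_betaPt_succ lam i
    have h2 := aux_betaPt_succ mu i
    rw [hb _ i.2, hb _ i.2.le] at h1
    linarith
  refine ⟨?_, hlam⟩
  subst hlam
  have hval : ∀ (σ : Equiv.Perm (Fin m)), T = ietMap σ lam → ∀ i : Fin m,
      T (betaPt lam (i : ℕ)) = ∑ k ∈ Finset.univ.filter (fun k => σ k < σ i), lam k := by
    intro σ hσ i
    rw [hσ, aux_ietMap_eq σ lam hpos (j := i) ⟨le_rfl, by linarith [hpos i]⟩]
    ring
  refine aux_perm_unique π ρ fun i j => ?_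
  rw [aux_sum_lt_iff π lam hpos, aux_sum_lt_iff ρ lam hpos, ← hval π hTe, ← hval π hTe,
    ← hval ρ hTe', ← hval ρ hTe']

theorem aux_exists {m : ℕ} {T : ℝ → ℝ} (hT : IsIET T) (S : Finset ℝ) (hS : S.card = m)
    (hSD : (S : Set ℝ) = insert 0 (DiscSet T)) (hm : 1 ≤ m) :
    ∃ (π : Equiv.Perm (Fin m)) (lam : Fin m → ℝ), Separating π ∧ (∀ i, 0 < lam i) ∧
      ∑ i, lam i = 1 ∧ T = ietMap π lam := by
  classical
  have hSu : ∀ x ∈ S, x ∈ unitI := by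
    intro x hx
    have hx' : x ∈ insert 0 (DiscSet T) := by rw [← hSD]; exact hx
    rcases hx' with h | h
    · rw [h]; exact ⟨le_rfl, one_pos⟩
    · exact h.1
  have h0S : (0 : ℝ) ∈ S := by
    have : (0 : ℝ) ∈ (S : Set ℝ) := by rw [hSD]; exact Set.mem_insert _ _
    exact this
  set e := S.orderEmbOfFin hS with he
  have heS : ∀ i, e i ∈ S := fun i => Finset.orderEmbOfFin_mem S hS i
  have hrange : ∀ x ∈ S, ∃ i, e i = x := by
    intro x hx
    have : x ∈ Set.range e := by rw [he, Finset.range_orderEmbOfFin]; exact hx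
    exact this
  let γ : ℕ → ℝ := fun j => if h : j < m then e ⟨j, h⟩ else 1
  have hγe : ∀ i : Fin m, γ (i : ℕ) = e i := fun i => by simp [γ]
  have hγm : γ m = 1 := by simp [γ]
  have hγ0 : γ 0 = 0 := by
    have h1 : γ 0 = e ⟨0, hm⟩ := hγe ⟨0, hm⟩
    obtain ⟨i, hi⟩ := hrange 0 h0S
    have h2 : e ⟨0, hm⟩ ≤ e i := e.monotone (Fin.mk_le_of_le_val (Nat.zero_le _))
    have h3 := (hSu _ (heS ⟨0, hm⟩)).1
    linarith
  have hγlt : ∀ i : Fin m, γ (i : ℕ) < γ ((i : ℕ) + 1) := by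
    intro i
    rw [hγe]
    by_cases h : (i : ℕ) + 1 < m
    · have : γ ((i : ℕ) + 1) = e ⟨(i : ℕ) + 1, h⟩ := hγe ⟨(i : ℕ) + 1, h⟩
      rw [this]
      exact e.strictMono (Fin.lt_def.2 (Nat.lt_succ_self _))
    · have : γ ((i : ℕ) + 1) = 1 := by simp [γ, h]
      rw [this]
      exact (hSu _ (heS i)).2
  let lam : Fin m → ℝ := fun i => γ ((i : ℕ) + 1) - γ (i : ℕ)
  have hpos : ∀ i, 0 < lam i := fun i => sub_pos.2 (hγlt i)
  have hbeta : ∀ n ≤ m, betaPt lam n = γ n := by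
    intro n
    induction n with
    | zero => intro _; rw [aux_betaPt_zero, hγ0]
    | succ n ih =>
      intro hn
      have h1 := aux_betaPt_succ lam ⟨n, hn⟩
      simp only [lam] at h1
      rw [h1, ih (by omega)]
      ring
  have hsum : ∑ i, lam i = 1 := by rw [← aux_betaPt_last, hbeta m le_rfl, hγm]
  let g : Fin m → ℝ := fun i => betaPt lam (i : ℕ)
  have hge : ∀ i, g i = e i := fun i => (hbeta _ i.2.le).trans (hγe i)
  have hg1 : ∀ i, g i + lam i = γ ((i : ℕ) + 1) := fun i => by
    simp only [g, lam, hbeta _ i.2.le]; ring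
  have hγle : ∀ i : Fin m, γ ((i : ℕ) + 1) ≤ 1 := by
    intro i
    by_cases h : (i : ℕ) + 1 < m
    · have : γ ((i : ℕ) + 1) = e ⟨(i : ℕ) + 1, h⟩ := hγe ⟨(i : ℕ) + 1, h⟩
      rw [this]
      exact (hSu _ (heS _)).2.le
    · simp [γ, h]
  have hg0 : ∀ i, 0 ≤ g i := fun i => by rw [hge]; exact (hSu _ (heS i)).1
  have hsub : ∀ i, Set.Ico (g i) (g i + lam i) ⊆ unitI := fun i x hx =>
    ⟨(hg0 i).trans hx.1, hx.2.trans_le (by rw [hg1]; exact hγle i)⟩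
  have hmem : ∀ i, g i ∈ Set.Ico (g i) (g i + lam i) := fun i => ⟨le_rfl, by linarith [hpos i]⟩
  have htr : ∀ i, ∀ x ∈ Set.Ico (g i) (g i + lam i), T x = T (g i) + (x - g i) := by
    intro i
    refine aux_translation hT (hg0 i) (by rw [hg1]; exact hγle i) ?_
    intro x hx hxD
    have hxS : x ∈ (S : Set ℝ) := by rw [hSD]; exact Set.mem_insert_of_mem _ hxD
    obtain ⟨k, rfl⟩ := hrange x hxS
    have h1 : i < k := by
      have := hx.1
      rw [hge] at this
      exact e.lt_iff_lt.1 this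
    have h2 := hx.2
    rw [← hge] at h2
    have hk : g k ∈ Set.Ico (g i) (g i + lam i) := ⟨by rw [hge k]; exact hx.1.le, h2⟩
    exact h1.ne (aux_beta_unique lam hpos hk (hmem k))
  have huniq : ∀ x i j, x ∈ Set.Ico (g i) (g i + lam i) → x ∈ Set.Ico (g j) (g j + lam j) →
      i = j := fun x i j hi hj => aux_beta_unique lam hpos hi hj
  have hcov : ∀ x ∈ unitI, ∃ i, x ∈ Set.Ico (g i) (g i + lam i) := fun x hx =>
    aux_beta_locate lam hsum hx
  have hinj : Function.Injective (fun i => T (g i)) := by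
    intro i j hij
    have := hT.1.injOn (hsub i (hmem i)) (hsub j (hmem j)) hij
    rw [hge, hge] at this
    exact e.injective this
  obtain ⟨π, hπ⟩ := aux_perm _ hinj
  have hval : ∀ j, T (g j) = ∑ i ∈ Finset.univ.filter (fun i => π i < π j), lam i := by
    intro j
    rw [aux_sum T hT g lam hpos hsub hcov huniq htr j]
    refine Finset.sum_congr ?_ (fun _ _ => rfl)
    ext i
    simp [hπ]
  refine ⟨π, lam, ?_, hpos, hsum, ?_⟩
  · intro i j hij hc
    have hfil : Finset.univ.filter (fun k => π k < π j) =
        insert i (Finset.univ.filter (fun k => π k < π i)) := by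
      ext k
      simp only [Finset.mem_filter, Finset.mem_univ, true_and, Finset.mem_insert]
      rw [← π.injective.eq_iff (a := k), Fin.ext_iff, Fin.lt_def, Fin.lt_def]
      omega
    have hvj : T (g j) = T (g i) + lam i := by
      rw [hval j, hval i, hfil, Finset.sum_insert (by simp)]
      ring
    have hgj : g j = g i + lam i := by
      simp only [g]
      rw [hij, aux_betaPt_succ]
    have hlt : g i < g j := by linarith [hpos i]
    have hjS : g j ∈ insert 0 (DiscSet T) := by
      rw [← hSD, hge]; exact heS j
    rcases hjS with h | h
    · linarith [hg0 i]
    · refine h.2 (ContinuousAt.continuousWithinAt ?_)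
      have hcn : ContinuousAt (fun y => T (g i) + (y - g i)) (g j) := by fun_prop
      refine hcn.congr ?_
      filter_upwards [Ioo_mem_nhds hlt (hmem j).2] with y hy
      by_cases hy' : y < g j
      · exact (htr i y ⟨hy.1.le, by linarith⟩).symm
      · rw [htr j y ⟨not_lt.1 hy', hy.2⟩, hvj]
        linarith
  · funext x
    by_cases hx : x ∈ unitI
    · obtain ⟨j, hj⟩ := hcov x hx
      rw [htr j x hj, aux_ietMap_eq π lam hpos hj, hval j]
      simp only [g]
      ring
    · rw [hT.2.1 x hx]
      unfold ietMap
      rw [dif_neg]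
      rintro ⟨j, hj⟩
      exact hx (hsub j hj)

theorem stmt7 (T : ℝ → ℝ) (m : ℕ) (hm : 1 ≤ m) (hT : IsIET T)
    (hfin : (DiscSet T).Finite) (hcard : (DiscSet T).ncard = m - 1) :
    ∃! p : Equiv.Perm (Fin m) × (Fin m → ℝ),
      Separating p.1 ∧ (∀ i, 0 < p.2 i) ∧ (∑ i, p.2 i) = 1 ∧
      T = ietMap p.1 p.2 := by
  classical
  have h0 := aux_disc_pos hT
  have hSD : ((insert 0 hfin.toFinset : Finset ℝ) : Set ℝ) = insert 0 (DiscSet T) := by simp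
  have hS : (insert 0 hfin.toFinset : Finset ℝ).card = m := by
    rw [Finset.card_insert_of_notMem (by simpa using h0),
      ← Set.ncard_eq_toFinset_card _ hfin, hcard]
    omega
  obtain ⟨π, lam, h1, h2, h3, h4⟩ := aux_exists hT _ hS hSD hm
  refine ⟨(π, lam), ⟨h1, h2, h3, h4⟩, ?_⟩
  rintro ⟨ρ, mu⟩ ⟨-, h2', h3', h4'⟩
  obtain ⟨ha, hb⟩ := aux_unique _ hS hSD hm ρ π mu lam h2' h3' h4' h2 h3 h4
  exact Prod.ext ha hb

end IETRoots
end
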